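/- arXiv:2507.00326 — 2 statements merged into one kernel-verified Lean document; each statement's English description precedes it below -/
import Mathlib

section
/- Under Hypothesis H, the zeta series ζ_{N,n}(s,w,M) := Σ_{k ∈ ℕ_0^N} Π_{j=1}^n (w_j + k_1 a_{1j} + ⋯ + k_N a_{Nj})^{−s} converges absolutely whenever Re(s) > N/(n − Z_M) and Re(w_j) > 0 for all j, the convergence being uniform on compact subsets of {s : Re(s) > N/(n − Z_M)} × {w ∈ ℂ^n : Re(w_j) > 0 for 1 ≤ j ≤ n}, and the function (s,w) ↦ ζ_{N,n}(s,w,M) is analytic on this domain. -/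
open MeasureTheory Complex
open scoped Classical

noncomputable section

/-- Hypothesis H: each entry of the matrix either vanishes or has positive real part,
and no row vanishes. -/
def HypH {N n : ℕ} (a : Fin N → Fin n → ℂ) : Prop :=
  (∀ i j, a i j = 0 ∨ 0 < (a i j).re) ∧ ∀ i, ∃ j, a i j ≠ 0

/-- `Z_M`: the maximal number of vanishing entries in a row. -/
def ZM {N n : ℕ} (a : Fin N → Fin n → ℂ) : ℕ :=
  Finset.univ.sup fun i => (Finset.univ.filter fun j => a i j = 0).card

/-- The Shintani–Barnes zeta series `ζ_{N,n}(s,w,M)`. -/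
def zetaSeries {N n : ℕ} (a : Fin N → Fin n → ℂ) (s : ℂ) (w : Fin n → ℂ) : ℂ :=
  ∑' k : Fin N → ℕ, ∏ j, (w j + ∑ i, (k i : ℂ) * a i j) ^ (-s)

open BoundedContinuousFunction in
/-- Locally in `h`, the sequence `k ↦ log (1 + h ε k)` depends analytically on `h`, as an
element of the Banach algebra of bounded functions. -/
theorem exists_analyticAt_log_one_add_mul {X : Type*} [TopologicalSpace X] (ε : X →ᵇ ℂ) :
    ∃ P : ℂ → (X →ᵇ ℂ), AnalyticAt ℂ P 0 ∧
      ∀ᶠ h in nhds (0 : ℂ), ∀ k, ‖h * ε k‖ < 1 / 2 ∧ P h k = log (1 + h * ε k) := by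
  set r : ℝ := 1 / (2 * (‖ε‖ + 1)) with hr
  have hr0 : 0 < r := by positivity
  have hrε : r * ‖ε‖ < 1 / 2 := by
    rw [hr, div_mul_eq_mul_div, div_lt_div_iff₀ (by positivity) (by positivity)]
    linarith
  let F : ℕ → ℂ → (X →ᵇ ℂ) := fun m h => ((-1) ^ (m + 1) * h ^ m / m : ℂ) • ε ^ m
  have hsum : Summable fun m : ℕ => ((1 / 2 : ℝ)) ^ m * ‖(1 : X →ᵇ ℂ)‖ + (1 / 2 : ℝ) ^ m :=
    (summable_geometric_two.mul_right _).add summable_geometric_two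
  have hbound : ∀ m, ∀ h ∈ Metric.ball (0 : ℂ) r,
      ‖F m h‖ ≤ (1 / 2 : ℝ) ^ m * ‖(1 : X →ᵇ ℂ)‖ + (1 / 2 : ℝ) ^ m := by
    intro m h hh
    have hh' : ‖h‖ < r := by simpa using hh
    rcases Nat.eq_zero_or_pos m with rfl | hm
    · simp [F]
      positivity
    have h1 : ‖F m h‖ ≤ ‖h‖ ^ m / m * ‖ε‖ ^ m := by
      refine (norm_smul_le _ _).trans ?_
      have : ‖((-1) ^ (m + 1) * h ^ m / m : ℂ)‖ = ‖h‖ ^ m / m := by simp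
      rw [this]
      gcongr
      exact norm_pow_le' _ hm
    have h2 : ‖h‖ ^ m / m * ‖ε‖ ^ m ≤ ‖h‖ ^ m * ‖ε‖ ^ m := by
      gcongr
      exact div_le_self (by positivity) (by exact_mod_cast hm)
    have h3 : ‖h‖ ^ m * ‖ε‖ ^ m ≤ (1 / 2 : ℝ) ^ m := by
      rw [← mul_pow]
      gcongr
      nlinarith [norm_nonneg ε]
    have : 0 ≤ (1 / 2 : ℝ) ^ m * ‖(1 : X →ᵇ ℂ)‖ := by positivity
    linarith
  refine ⟨fun h => ∑' m, F m h, ?_, ?_⟩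
  · refine (differentiableOn_tsum_of_summable_norm hsum (fun m => ?_) Metric.isOpen_ball
      hbound).analyticAt (Metric.ball_mem_nhds 0 hr0)
    intro h _
    exact DifferentiableAt.differentiableWithinAt (by fun_prop)
  · filter_upwards [Metric.ball_mem_nhds (0 : ℂ) hr0] with h hh k
    have hh' : ‖h‖ < r := by simpa using hh
    have hk : ‖h * ε k‖ < 1 / 2 := by
      rw [norm_mul]
      have := ε.norm_coe_le_norm k
      nlinarith [norm_nonneg (ε k), norm_nonneg h]
    refine ⟨hk, ?_⟩
    have hs : Summable fun m => F m h :=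
      Summable.of_norm_bounded hsum fun m => hbound m h hh
    have h1 := hs.hasSum.mapL (evalCLM ℂ k)
    have h2 := hasSum_taylorSeries_log (z := h * ε k) (by linarith)
    refine h1.unique (h2.congr_fun ?_)
    intro m
    simp [F, mul_pow]
    ring

/-- If the terms `A k s` are holomorphic in `s` and dominated by a summable sequence, then the
functional `g ↦ ∑' k, A k s * g k` on bounded functions is holomorphic in `s`. -/
theorem exists_differentiableOn_tsum_apply {X : Type*} [TopologicalSpace X]
    {A : X → ℂ → ℂ} {b : X → ℝ} {U : Set ℂ} (hU : IsOpen U) (hb : Summable b)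
    (hA : ∀ k, DifferentiableOn ℂ (A k) U) (hAb : ∀ k, ∀ s ∈ U, ‖A k s‖ ≤ b k) :
    ∃ T : ℂ → (BoundedContinuousFunction X ℂ →L[ℂ] ℂ), DifferentiableOn ℂ T U ∧
      ∀ s ∈ U, ∀ g, T s g = ∑' k, A k s * g k := by
  let e : X → (BoundedContinuousFunction X ℂ →L[ℂ] ℂ) :=
    fun k => BoundedContinuousFunction.evalCLM ℂ k
  let F : X → ℂ → (BoundedContinuousFunction X ℂ →L[ℂ] ℂ) := fun k s => A k s • e k
  have heval : ∀ k : X, ‖e k‖ ≤ 1 := fun k =>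
    ContinuousLinearMap.opNorm_le_bound _ zero_le_one fun g => by
      rw [one_mul]
      exact g.norm_coe_le_norm k
  have hF : ∀ k, ∀ s ∈ U, ‖F k s‖ ≤ b k := fun k s hs => by
    have h1 : ‖F k s‖ ≤ ‖A k s‖ * ‖e k‖ := norm_smul_le (A k s) (e k)
    exact h1.trans ((mul_le_of_le_one_right (norm_nonneg _) (heval k)).trans (hAb k s hs))
  refine ⟨fun s => ∑' k, F k s, differentiableOn_tsum_of_summable_norm (F := F) hb
    (fun k => (hA k).smul_const (e k)) hU hF, fun s hs g => ?_⟩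
  have hs' : Summable fun k => F k s := Summable.of_norm_bounded hb fun k => hF k s hs
  have := hs'.hasSum.mapL (ContinuousLinearMap.apply ℂ ℂ g)
  exact this.tsum_eq.symm.trans (by simp [F, e])

theorem summable_pi_prod {f : ℕ → ℝ} (hf : Summable f) (hf0 : 0 ≤ f) (N : ℕ) :
    Summable fun k : Fin N → ℕ => ∏ i, f (k i) := by
  induction N with
  | zero => exact Summable.of_finite
  | succ N ih =>
    rw [← (Fin.consEquiv fun _ => ℕ).summable_iff]
    refine (hf.mul_of_nonneg ih hf0 fun k => Finset.prod_nonneg fun i _ => hf0 _).congr ?_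
    rintro ⟨x, y⟩
    simp [Fin.prod_univ_succ, Fin.consEquiv]

theorem cpow_add_eq_mul_exp {z h s : ℂ} (hz : 0 < z.re) (hh : ‖h * z⁻¹‖ < 1 / 2) :
    (z + h) ^ (-s) = z ^ (-s) * exp (-s * log (1 + h * z⁻¹)) := by
  have hz0 : z ≠ 0 := by rintro rfl; simp at hz
  have hre : 0 < (1 + h * z⁻¹).re := by
    have := (abs_le.1 (abs_re_le_norm (h * z⁻¹))).1
    simp only [add_re, one_re]
    linarith
  have hu0 : 1 + h * z⁻¹ ≠ 0 := by intro h0; simp [h0] at hre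
  have hmul : z + h = z * (1 + h * z⁻¹) := by field_simp
  have hlog : log (z * (1 + h * z⁻¹)) = log z + log (1 + h * z⁻¹) := by
    refine log_mul hz0 hu0 ?_
    have h1 := abs_lt.1 (abs_arg_lt_pi_div_two_iff.2 (Or.inl hz))
    have h2 := abs_lt.1 (abs_arg_lt_pi_div_two_iff.2 (Or.inl hre))
    constructor <;> linarith [h1.1, h1.2, h2.1, h2.2]
  rw [hmul, cpow_def_of_ne_zero (mul_ne_zero hz0 hu0), cpow_def_of_ne_zero hz0, hlog, ← exp_add]
  ring_nf

section Bounds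

variable {N n : ℕ} {a : Fin N → Fin n → ℂ}

theorem ZM_lt (hn : 0 < n) (hH : HypH a) : ZM a < n := by
  refine (Finset.sup_lt_iff (by simpa using hn)).2 fun i _ => ?_
  obtain ⟨j, hj⟩ := hH.2 i
  have : (Finset.univ.filter fun j => a i j = 0).card < (Finset.univ : Finset (Fin n)).card :=
    Finset.card_lt_card (Finset.filter_ssubset.2 ⟨j, Finset.mem_univ j, hj⟩)
  simpa using this

/-- The size of the `j`-th linear form at `k`. -/
def formSize (a : Fin N → Fin n → ℂ) (k : Fin N → ℕ) (j : Fin n) : ℝ :=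
  1 + ∑ i, if a i j = 0 then 0 else (k i : ℝ)

theorem one_le_formSize (k : Fin N → ℕ) (j : Fin n) : 1 ≤ formSize a k j := by
  have : 0 ≤ ∑ i, if a i j = 0 then 0 else (k i : ℝ) :=
    Finset.sum_nonneg fun i _ => by split_ifs <;> positivity
  unfold formSize
  linarith

theorem one_add_le_formSize (k : Fin N → ℕ) {i : Fin N} {j : Fin n} (h : a i j ≠ 0) :
    1 + (k i : ℝ) ≤ formSize a k j := by
  have := Finset.single_le_sum (f := fun i => if a i j = 0 then 0 else (k i : ℝ))
    (fun i _ => by split_ifs <;> positivity) (Finset.mem_univ i)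
  simp only [h, if_false] at this
  unfold formSize
  linarith

theorem pow_le_prod_formSize (k : Fin N → ℕ) (i : Fin N) :
    (1 + (k i : ℝ)) ^ (n - ZM a) ≤ ∏ j, formSize a k j := by
  have hq : 1 ≤ 1 + (k i : ℝ) := by simp
  have hcard : n - ZM a ≤ (Finset.univ.filter fun j => a i j ≠ 0).card := by
    have h1 := Finset.card_filter_add_card_filter_not (s := (Finset.univ : Finset (Fin n)))
      (fun j => a i j = 0)
    have h2 : (Finset.univ.filter fun j => a i j = 0).card ≤ ZM a :=
      Finset.le_sup (f := fun i => (Finset.univ.filter fun j => a i j = 0).card)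
        (Finset.mem_univ i)
    simp only [Finset.card_univ, Fintype.card_fin] at h1
    simp only [ne_eq]
    omega
  calc (1 + (k i : ℝ)) ^ (n - ZM a)
      ≤ (1 + (k i : ℝ)) ^ (Finset.univ.filter fun j => a i j ≠ 0).card :=
        pow_le_pow_right₀ hq hcard
    _ = ∏ j ∈ Finset.univ.filter fun j => a i j ≠ 0, (1 + (k i : ℝ)) := by simp
    _ = ∏ j, if a i j ≠ 0 then 1 + (k i : ℝ) else 1 := by rw [Finset.prod_filter]
    _ ≤ ∏ j, formSize a k j := by
        refine Finset.prod_le_prod (fun j _ => by split_ifs <;> positivity) fun j _ => ?_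
        split_ifs with h
        · exact one_add_le_formSize k h
        · exact one_le_formSize k j

theorem prod_formSize_rpow_le (hN : 0 < N) {σ : ℝ} (hσ : 0 ≤ σ) (k : Fin N → ℕ) :
    ∏ j, formSize a k j ^ (-σ) ≤
      ∏ i, (1 + (k i : ℝ)) ^ (-(σ * ((n - ZM a : ℕ) : ℝ) / N)) := by
  have : Nonempty (Fin N) := ⟨⟨0, hN⟩⟩
  obtain ⟨i, -, hi⟩ := Finset.exists_max_image Finset.univ k Finset.univ_nonempty
  have hq : 0 < 1 + (k i : ℝ) := by positivity
  have hN' : (N : ℝ) ≠ 0 := by positivity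
  set r := σ * ((n - ZM a : ℕ) : ℝ) / N with hr
  have hr0 : 0 ≤ r := by positivity
  calc ∏ j, formSize a k j ^ (-σ) = (∏ j, formSize a k j) ^ (-σ) :=
        Real.finsetProd_rpow _ _ (fun j _ => zero_le_one.trans (one_le_formSize k j)) _
    _ ≤ ((1 + (k i : ℝ)) ^ (n - ZM a)) ^ (-σ) :=
        Real.rpow_le_rpow_of_nonpos (by positivity) (pow_le_prod_formSize k i) (by linarith)
    _ = ((1 + (k i : ℝ)) ^ (-r)) ^ N := by
        rw [← Real.rpow_natCast, ← Real.rpow_natCast, ← Real.rpow_mul hq.le,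
          ← Real.rpow_mul hq.le, hr]
        congr 1
        field_simp
    _ = ∏ _i : Fin N, (1 + (k i : ℝ)) ^ (-r) := by simp
    _ ≤ ∏ i, (1 + (k i : ℝ)) ^ (-r) := by
        refine Finset.prod_le_prod (fun _ _ => by positivity) fun l _ => ?_
        refine Real.rpow_le_rpow_of_nonpos (by positivity) ?_ (by linarith)
        have := hi l (Finset.mem_univ l)
        gcongr

theorem summable_prod_formSize_rpow (hN : 0 < N) (hn : 0 < n) (hH : HypH a) {σ : ℝ}
    (hσ : (N : ℝ) / ((n : ℝ) - (ZM a : ℝ)) < σ) :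
    Summable fun k : Fin N → ℕ => ∏ j, formSize a k j ^ (-σ) := by
  have hZ := ZM_lt hn hH
  have hd : ((n - ZM a : ℕ) : ℝ) = (n : ℝ) - ZM a := by push_cast [hZ.le]; rfl
  have hd0 : (0 : ℝ) < (n : ℝ) - ZM a := by rw [← hd]; exact_mod_cast Nat.sub_pos_of_lt hZ
  have hN' : (0 : ℝ) < N := by exact_mod_cast hN
  have hσ0 : 0 ≤ σ := le_of_lt (lt_of_le_of_lt (by positivity) hσ)
  set r := σ * ((n - ZM a : ℕ) : ℝ) / N with hr
  have hr1 : 1 < r := by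
    rw [hr, hd, lt_div_iff₀ hN', one_mul]
    exact (div_lt_iff₀ hd0).1 hσ
  have hs : Summable fun m : ℕ => (1 + (m : ℝ)) ^ (-r) := by
    refine ((summable_nat_add_iff 1).2 (Real.summable_nat_rpow.2 (neg_lt_neg hr1))).congr ?_
    intro m
    push_cast
    rw [add_comm]
  refine Summable.of_nonneg_of_le (fun k => Finset.prod_nonneg fun j _ =>
    Real.rpow_nonneg (zero_le_one.trans (one_le_formSize k j)) _)
    (fun k => prod_formSize_rpow_le hN hσ0 k)
    (summable_pi_prod hs (fun m => by positivity) N)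

theorem mul_formSize_le_re {c : ℝ} (hc : ∀ i j, a i j ≠ 0 → c ≤ (a i j).re)
    {z : ℂ} {j : Fin n} (hz : c ≤ z.re) (k : Fin N → ℕ) :
    c * formSize a k j ≤ (z + ∑ i, (k i : ℂ) * a i j).re := by
  simp only [formSize, add_re, re_sum, mul_add, mul_one, Finset.mul_sum]
  gcongr with i
  split_ifs with h
  · simp [h]
  · have := hc i j h
    simp only [mul_re, natCast_re, natCast_im, zero_mul, sub_zero]
    rw [mul_comm]
    gcongr

theorem re_form_pos (hH : HypH a) {z : ℂ} {j : Fin n} (hz : 0 < z.re) (k : Fin N → ℕ) :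
    0 < (z + ∑ i, (k i : ℂ) * a i j).re := by
  simp only [add_re, re_sum]
  refine add_pos_of_pos_of_nonneg hz (Finset.sum_nonneg fun i _ => ?_)
  rcases hH.1 i j with h | h
  · simp [h]
  · simp only [mul_re, natCast_re, natCast_im, zero_mul, sub_zero]
    positivity

theorem norm_cpow_neg_le {z s : ℂ} {c m σ S B : ℝ} (hc : 0 < c) (hc1 : c ≤ 1) (hm : 1 ≤ m)
    (hz : c * m ≤ z.re) (hσ0 : 0 ≤ σ) (hσ : σ ≤ s.re) (hS : s.re ≤ S) (hB : |s.im| ≤ B) :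
    ‖z ^ (-s)‖ ≤ c ^ (-S) * Real.exp (Real.pi * B) * m ^ (-σ) := by
  have hcm : 0 < c * m := by positivity
  have hz0 : z ≠ 0 := by rintro rfl; simp at hz; linarith
  have hzn : c * m ≤ ‖z‖ := hz.trans (re_le_norm z)
  have harg : -(z.arg * (-s).im) ≤ Real.pi * B := by
    calc -(z.arg * (-s).im) ≤ |z.arg * s.im| := by
          simpa using le_abs_self (z.arg * s.im)
      _ = |z.arg| * |s.im| := abs_mul _ _
      _ ≤ Real.pi * B := by
          gcongr
          exact abs_arg_le_pi z
  rw [norm_cpow_of_ne_zero hz0, div_eq_mul_inv, ← Real.exp_neg]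
  calc ‖z‖ ^ (-s).re * Real.exp (-(z.arg * (-s).im))
      ≤ (c * m) ^ (-s).re * Real.exp (Real.pi * B) := by
        gcongr ?_ * ?_
        · exact Real.rpow_le_rpow_of_nonpos hcm hzn (by rw [neg_re]; linarith)
        · exact Real.exp_le_exp.2 harg
    _ = c ^ (-s.re) * m ^ (-s.re) * Real.exp (Real.pi * B) := by
        rw [neg_re, Real.mul_rpow hc.le (by linarith)]
    _ ≤ c ^ (-S) * m ^ (-σ) * Real.exp (Real.pi * B) := by
        have h1 : c ^ (-s.re) ≤ c ^ (-S) :=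
          Real.rpow_le_rpow_of_exponent_ge hc hc1 (by linarith)
        have h2 : m ^ (-s.re) ≤ m ^ (-σ) := Real.rpow_le_rpow_of_exponent_le hm (by linarith)
        have : 0 ≤ m ^ (-s.re) := by positivity
        gcongr
    _ = _ := by ring

theorem exists_summable_bound_nhds (hN : 0 < N) (hn : 0 < n) (hH : HypH a)
    {p₀ : ℂ × (Fin n → ℂ)} (hs : (N : ℝ) / ((n : ℝ) - (ZM a : ℝ)) < p₀.1.re)
    (hw : ∀ j, 0 < (p₀.2 j).re) :
    ∃ b : (Fin N → ℕ) → ℝ, Summable b ∧ ∀ᶠ p in nhds p₀, ∀ k : Fin N → ℕ,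
      ‖∏ j, (p.2 j + ∑ i, (k i : ℂ) * a i j) ^ (-p.1)‖ ≤ b k := by
  have hlt : ∀ x : ℝ, 0 < x → ∀ᶠ c in nhdsWithin (0 : ℝ) (Set.Ioi 0), c < x := fun x hx =>
    nhdsWithin_le_nhds (eventually_lt_nhds hx)
  obtain ⟨c, ⟨⟨hc1, hca⟩, hcw⟩, hc0⟩ :
      ∃ c : ℝ, ((c < 1 ∧ ∀ i j, a i j ≠ 0 → c < (a i j).re) ∧ ∀ j, c < (p₀.2 j).re) ∧ 0 < c := by
    refine ((((hlt 1 one_pos).and ?_).and ?_).and self_mem_nhdsWithin).exists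
    · refine Filter.eventually_all.2 fun i => Filter.eventually_all.2 fun j => ?_
      rcases hH.1 i j with h | h
      · simp [h]
      · exact (hlt _ h).mono fun c hc _ => hc
    · exact Filter.eventually_all.2 fun j => hlt _ (hw j)
  obtain ⟨σ, hσ, hσs⟩ := exists_between hs
  have hσ0 : 0 ≤ σ := by
    have hZ : (ZM a : ℝ) < n := by exact_mod_cast ZM_lt hn hH
    have : 0 < (n : ℝ) - ZM a := by linarith
    exact le_of_lt (lt_of_le_of_lt (by positivity) hσ)
  set C : ℝ := c ^ (-(p₀.1.re + 1)) * Real.exp (Real.pi * (|p₀.1.im| + 1)) with hC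
  refine ⟨fun k => C ^ n * ∏ j, formSize a k j ^ (-σ),
    (summable_prod_formSize_rpow hN hn hH hσ).mul_left _, ?_⟩
  have e1 : ∀ᶠ p : ℂ × (Fin n → ℂ) in nhds p₀, σ < p.1.re :=
    (by fun_prop : ContinuousAt (fun p : ℂ × (Fin n → ℂ) => p.1.re) p₀).eventually
      (eventually_gt_nhds hσs)
  have e2 : ∀ᶠ p : ℂ × (Fin n → ℂ) in nhds p₀, p.1.re < p₀.1.re + 1 :=
    (by fun_prop : ContinuousAt (fun p : ℂ × (Fin n → ℂ) => p.1.re) p₀).eventually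
      (eventually_lt_nhds (by simp))
  have e3 : ∀ᶠ p : ℂ × (Fin n → ℂ) in nhds p₀, |p.1.im| < |p₀.1.im| + 1 :=
    (by fun_prop : ContinuousAt (fun p : ℂ × (Fin n → ℂ) => |p.1.im|) p₀).eventually
      (eventually_lt_nhds (by simp))
  have e4 : ∀ᶠ p : ℂ × (Fin n → ℂ) in nhds p₀, ∀ j, c < (p.2 j).re :=
    Filter.eventually_all.2 fun j =>
      (by fun_prop : ContinuousAt (fun p : ℂ × (Fin n → ℂ) => (p.2 j).re) p₀).eventually
        (eventually_gt_nhds (hcw j))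
  filter_upwards [e1, e2, e3, e4] with p h1 h2 h3 h4 k
  rw [norm_prod]
  calc ∏ j, ‖(p.2 j + ∑ i, (k i : ℂ) * a i j) ^ (-p.1)‖
      ≤ ∏ j, C * formSize a k j ^ (-σ) := by
        refine Finset.prod_le_prod (fun _ _ => norm_nonneg _) fun j _ => ?_
        exact norm_cpow_neg_le hc0 hc1.le (one_le_formSize k j)
          (mul_formSize_le_re (fun i j h => (hca i j h).le) (h4 j).le k) hσ0 h1.le h2.le h3.le
    _ = C ^ n * ∏ j, formSize a k j ^ (-σ) := by simp [Finset.prod_mul_distrib]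

theorem exists_summable_bound_of_isCompact (hN : 0 < N) (hn : 0 < n) (hH : HypH a)
    {K : Set (ℂ × (Fin n → ℂ))} (hK : IsCompact K)
    (hKs : K ⊆ {p | (N : ℝ) / ((n : ℝ) - (ZM a : ℝ)) < p.1.re ∧ ∀ j, 0 < (p.2 j).re}) :
    ∃ b : (Fin N → ℕ) → ℝ, Summable b ∧ ∀ p ∈ K, ∀ k : Fin N → ℕ,
      ‖∏ j, (p.2 j + ∑ i, (k i : ℂ) * a i j) ^ (-p.1)‖ ≤ b k := by
  refine hK.induction_on (p := fun K => ∃ b : (Fin N → ℕ) → ℝ, Summable b ∧ ∀ p ∈ K,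
    ∀ k : Fin N → ℕ, ‖∏ j, (p.2 j + ∑ i, (k i : ℂ) * a i j) ^ (-p.1)‖ ≤ b k) ?_ ?_ ?_ ?_
  · exact ⟨0, summable_zero, by simp⟩
  · rintro s t hst ⟨b, hb, h⟩
    exact ⟨b, hb, fun p hp => h p (hst hp)⟩
  · rintro s t ⟨b, hb, h⟩ ⟨b', hb', h'⟩
    refine ⟨fun k => |b k| + |b' k|, hb.abs.add hb'.abs, ?_⟩
    rintro p (hp | hp) k
    · linarith [h p hp k, le_abs_self (b k), abs_nonneg (b' k)]
    · linarith [h' p hp k, le_abs_self (b' k), abs_nonneg (b k)]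
  · intro p hp
    obtain ⟨b, hb, h⟩ := exists_summable_bound_nhds hN hn hH (hKs hp).1 (hKs hp).2
    exact ⟨_, mem_nhdsWithin_of_mem_nhds h, b, hb, fun q hq => hq⟩

theorem analyticAt_zetaSeries (hN : 0 < N) (hn : 0 < n) (hH : HypH a)
    {p₀ : ℂ × (Fin n → ℂ)} (hs : (N : ℝ) / ((n : ℝ) - (ZM a : ℝ)) < p₀.1.re)
    (hw : ∀ j, 0 < (p₀.2 j).re) :
    AnalyticAt ℂ (fun p : ℂ × (Fin n → ℂ) => zetaSeries a p.1 p.2) p₀ := by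
  let z : (Fin N → ℕ) → Fin n → ℂ := fun k j => p₀.2 j + ∑ i, (k i : ℂ) * a i j
  have hz : ∀ k j, 0 < (z k j).re := fun k j => re_form_pos hH (hw j) k
  have hz0 : ∀ k j, z k j ≠ 0 := fun k j h => by simpa [h] using hz k j
  let A : (Fin N → ℕ) → ℂ → ℂ := fun k s => ∏ j, z k j ^ (-s)
  obtain ⟨b, hb, hbound⟩ := exists_summable_bound_nhds hN hn hH hs hw
  have hbound' : ∀ᶠ s in nhds p₀.1, ∀ k, ‖A k s‖ ≤ b k :=
    (by fun_prop : ContinuousAt (fun s : ℂ => (s, p₀.2)) p₀.1).eventually hbound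
  obtain ⟨U, hUb, hU, hsU⟩ := eventually_nhds_iff.1 hbound'
  obtain ⟨T, hT, hTapply⟩ := exists_differentiableOn_tsum_apply hU hb (A := A)
    (fun k => DifferentiableOn.fun_finsetProd fun j _ s _ =>
      ((differentiableAt_id.neg).const_cpow (Or.inl (hz0 k j))).differentiableWithinAt)
    (fun k s hs => hUb s hs k)
  have hεle : ∀ k j, ‖(z k j)⁻¹‖ ≤ ((p₀.2 j).re)⁻¹ := fun k j => by
    rw [norm_inv]
    have : (p₀.2 j).re ≤ (z k j).re := by
      simp only [z, add_re, re_sum, le_add_iff_nonneg_right]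
      refine Finset.sum_nonneg fun i _ => ?_
      rcases hH.1 i j with h | h
      · simp [h]
      · simp only [mul_re, natCast_re, natCast_im, zero_mul, sub_zero]
        positivity
    exact inv_anti₀ (hw j) (this.trans (re_le_norm _))
  let ε : Fin n → BoundedContinuousFunction (Fin N → ℕ) ℂ := fun j =>
    BoundedContinuousFunction.ofNormedAddCommGroupDiscrete (fun k => (z k j)⁻¹) _
      fun k => hεle k j
  choose P hP hPlog using fun j => exists_analyticAt_log_one_add_mul (ε j)
  let G : ℂ × (Fin n → ℂ) → BoundedContinuousFunction (Fin N → ℕ) ℂ := fun p =>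
    NormedSpace.exp ((-p.1) • ∑ j, P j (p.2 j - p₀.2 j))
  have hcoord : ∀ j, AnalyticAt ℂ (fun p : ℂ × (Fin n → ℂ) => p.2 j - p₀.2 j) p₀ := fun j =>
    (((ContinuousLinearMap.proj (R := ℂ) (φ := fun _ : Fin n => ℂ) j).comp
      (ContinuousLinearMap.snd ℂ ℂ (Fin n → ℂ))).analyticAt p₀).sub analyticAt_const
  have hPc : ∀ j, AnalyticAt ℂ (fun p : ℂ × (Fin n → ℂ) => P j (p.2 j - p₀.2 j)) p₀ := fun j =>
    AnalyticAt.fun_comp (by simpa using hP j) (hcoord j)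
  have hG : AnalyticAt ℂ G p₀ :=
    (NormedSpace.exp_analytic _).fun_comp (analyticAt_fst.neg.smul
      (Finset.analyticAt_fun_sum _ fun j _ => hPc j))
  have hTG : AnalyticAt ℂ (fun p => T p.1 (G p)) p₀ := by
    have hT1 : AnalyticAt ℂ (fun p : ℂ × (Fin n → ℂ) => T p.1) p₀ :=
      AnalyticAt.fun_comp (hT.analyticAt (hU.mem_nhds hsU)) analyticAt_fst
    exact AnalyticAt.fun_comp (ContinuousLinearMap.analyticAt_bilinear
      (ContinuousLinearMap.id ℂ (BoundedContinuousFunction (Fin N → ℕ) ℂ →L[ℂ] ℂ)) _)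
      (hT1.prod hG)
  refine hTG.congr ?_
  have e1 : ∀ᶠ p : ℂ × (Fin n → ℂ) in nhds p₀, p.1 ∈ U :=
    continuousAt_fst.eventually (hU.mem_nhds hsU)
  have e2 : ∀ᶠ p : ℂ × (Fin n → ℂ) in nhds p₀, ∀ j, ∀ k,
      ‖(p.2 j - p₀.2 j) * ε j k‖ < 1 / 2 ∧
        P j (p.2 j - p₀.2 j) k = log (1 + (p.2 j - p₀.2 j) * ε j k) :=
    Filter.eventually_all.2 fun j =>
      ((hcoord j).continuousAt.tendsto.mono_right (by simp)).eventually (hPlog j)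
  filter_upwards [e1, e2] with p h1 h2
  rw [hTapply _ h1, zetaSeries]
  refine tsum_congr fun k => ?_
  have hGk : G p k = exp (-p.1 * ∑ j, log (1 + (p.2 j - p₀.2 j) * (z k j)⁻¹)) := by
    let _ : NormedAlgebra ℚ (BoundedContinuousFunction (Fin N → ℕ) ℂ) :=
      NormedAlgebra.restrictScalars ℚ ℂ _
    let ev : BoundedContinuousFunction (Fin N → ℕ) ℂ →+* ℂ :=
      { toFun := fun g => g k
        map_one' := rfl
        map_mul' := fun _ _ => rfl
        map_zero' := rfl
        map_add' := fun _ _ => rfl }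
    have hev : Continuous ev := (BoundedContinuousFunction.evalCLM ℂ k).continuous
    have := NormedSpace.map_exp ev hev ((-p.1) • ∑ j, P j (p.2 j - p₀.2 j))
    rw [← exp_eq_exp_ℂ] at this
    refine this.trans (congrArg exp ?_)
    change (-p.1) * (∑ j, P j (p.2 j - p₀.2 j)) k = _
    rw [BoundedContinuousFunction.coe_sum, Finset.sum_apply]
    exact congrArg _ (Finset.sum_congr rfl fun j _ => (h2 j k).2)
  rw [hGk, Finset.mul_sum, exp_sum, ← Finset.prod_mul_distrib]
  refine Finset.prod_congr rfl fun j _ => ?_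
  rw [← cpow_add_eq_mul_exp (hz k j) (h2 j k).1]
  congr 1
  simp only [z]
  ring

end Bounds

/-- Under Hypothesis H the zeta series converges absolutely for
`Re s > N/(n − Z_M)`, `Re w_j > 0`, uniformly on compact subsets of this region,
and is analytic in `(s,w)` there. -/
theorem zetaSeries_convergence_and_analytic {N n : ℕ} (hN : 0 < N) (hn : 0 < n)
    (a : Fin N → Fin n → ℂ) (hH : HypH a) :
    (∀ (s : ℂ) (w : Fin n → ℂ), (N : ℝ) / ((n : ℝ) - (ZM a : ℝ)) < s.re →
      (∀ j, 0 < (w j).re) →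
      Summable fun k : Fin N → ℕ => ‖∏ j, (w j + ∑ i, (k i : ℂ) * a i j) ^ (-s)‖) ∧
    (∀ K : Set (ℂ × (Fin n → ℂ)), IsCompact K →
      K ⊆ {p | (N : ℝ) / ((n : ℝ) - (ZM a : ℝ)) < p.1.re ∧ ∀ j, 0 < (p.2 j).re} →
      ∃ b : (Fin N → ℕ) → ℝ, Summable b ∧ ∀ p ∈ K, ∀ k : Fin N → ℕ,
        ‖∏ j, (p.2 j + ∑ i, (k i : ℂ) * a i j) ^ (-p.1)‖ ≤ b k) ∧
    AnalyticOnNhd ℂ (fun p : ℂ × (Fin n → ℂ) => zetaSeries a p.1 p.2)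
      {p | (N : ℝ) / ((n : ℝ) - (ZM a : ℝ)) < p.1.re ∧ ∀ j, 0 < (p.2 j).re} := by
  refine ⟨fun s w hs hw => ?_, fun K hK hKs => exists_summable_bound_of_isCompact hN hn hH hK hKs,
    fun p hp => analyticAt_zetaSeries hN hn hH hp.1 hp.2⟩
  obtain ⟨b, hb, h⟩ := exists_summable_bound_nhds hN hn hH (p₀ := (s, w)) hs hw
  exact Summable.of_nonneg_of_le (fun _ => norm_nonneg _) h.self_of_nhds hb
end
end

section
/- Under Hypothesis H, with Z a non-negative integer such that Z < n and no row of M has more than Z vanishing entries, the function I(s,w) := ∫_{T ∈ Δ} H(T,s,w,M) dT is analytic for Re(s) > N/(n − Z) and Re(w_k) > 0 (1 ≤ k ≤ n), it has a meromorphic continuation to (s,w) ∈ ℂ × {w ∈ ℂ^n : Re(w_k) > 0, 1 ≤ k ≤ n}, and for every integer M' ≥ N the function I(s,w)/Γ(ns − N) · Π_{p=0}^{M'} Π_{j=2}^n (p + s_j) is analytic in (s,w) on the region Re(s) > (N − M')/n, Re(w_k) > 0 (1 ≤ k ≤ n). -/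
open MeasureTheory Complex
open scoped Classical

noncomputable section

/-- `F_j`: the set of rows of the matrix starting with exactly `j` zeroes
(`j` is `0`-based here; the paper's `F_j` is our `Fj (j-1)`). -/
def Fj {N n : ℕ} (a : Fin N → Fin n → ℂ) (j : Fin n) : Finset (Fin N) :=
  Finset.univ.filter fun i => (∀ k : Fin n, (k : ℕ) < (j : ℕ) → a i k = 0) ∧ a i j ≠ 0

/-- The shifted variables `s_j` (0-based: the paper's `s_j` is our `sj (j-1)`):
`s_j = (n-j)s - Σ_{k=j}^{Z} |F_k|` for `0 ≤ j ≤ Z`, and `s_j = s` otherwise. -/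
def sj {N n : ℕ} (a : Fin N → Fin n → ℂ) (Z : ℕ) (s : ℂ) (j : Fin n) : ℂ :=
  if (j : ℕ) ≤ Z then
    ((n : ℂ) - (j : ℕ)) * s -
      ∑ k ∈ Finset.univ.filter (fun k : Fin n => (j : ℕ) ≤ (k : ℕ) ∧ (k : ℕ) ≤ Z),
        ((Fj a k).card : ℂ)
  else s

/-- The region `Δ`: `T_1 > T_2 > ⋯ > T_{Z+1}` and `T_{Z+1} > T_ℓ` for `ℓ ≥ Z+2`
(0-based: coordinates `0,…,Z` strictly decreasing and dominating the rest). -/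
def deltaRegion (n Z : ℕ) : Set (Fin n → ℝ) :=
  {T | (∀ j, 0 < T j) ∧ (∀ i j : Fin n, (i : ℕ) < (j : ℕ) → (j : ℕ) ≤ Z → T j < T i) ∧
    (∀ i l : Fin n, (i : ℕ) = Z → Z < (l : ℕ) → T l < T i)}

/-- The integrand `H(T,s,w,M)`. -/
def Hfun {N n : ℕ} (a : Fin N → Fin n → ℂ) (T : Fin n → ℝ) (s : ℂ) (w : Fin n → ℂ) : ℂ :=
  (∏ j, Complex.exp (-(w j) * (T j : ℂ)) * (T j : ℂ) ^ (s - 1)) /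
    ∏ i, (∑ j, a i j * (T j : ℂ))

/-- The integral `I(s,w) = ∫_{T ∈ Δ} H(T,s,w,M) dT`. -/
def Ifun {N n : ℕ} (a : Fin N → Fin n → ℂ) (Z : ℕ) (s : ℂ) (w : Fin n → ℂ) : ℂ :=
  ∫ T in deltaRegion n Z, Hfun a T s w

section Superposition

open BoundedContinuousFunction
open scoped NNReal ENNReal Topology

variable {X : Type*} [TopologicalSpace X] {V : Type*} [NormedAddCommGroup V] [NormedSpace ℂ V]

/-- The multilinear map on bounded continuous functions obtained by applying a multilinear form
pointwise. -/
def pointwiseMultilinear (X : Type*) [TopologicalSpace X] {k : ℕ}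
    (q : ContinuousMultilinearMap ℂ (fun _ : Fin k => V) ℂ) :
    ContinuousMultilinearMap ℂ (fun _ : Fin k => X →ᵇ V) (X →ᵇ ℂ) :=
  MultilinearMap.mkContinuous
    { toFun := fun h => BoundedContinuousFunction.ofNormedAddCommGroup
        (fun x => q fun i => h i x)
        (q.cont.comp (continuous_pi fun i => (h i).continuous))
        (‖q‖ * ∏ i, ‖h i‖)
        (fun x => (q.le_opNorm _).trans (by gcongr with i; exact (h i).norm_coe_le_norm x))
      map_update_add' := by
        intro _ m i x y
        have e : ∀ (v : X →ᵇ V) (t : X), (fun j => Function.update m i v j t) =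
            Function.update (fun j => m j t) i (v t) := by
          intro v t; ext j; by_cases hj : j = i
          · subst hj; simp
          · simp [hj]
        ext t
        simp [e]
      map_update_smul' := by
        intro _ m i c x
        have e : ∀ (v : X →ᵇ V) (t : X), (fun j => Function.update m i v j t) =
            Function.update (fun j => m j t) i (v t) := by
          intro v t; ext j; by_cases hj : j = i
          · subst hj; simp
          · simp [hj]
        ext t
        simp [e] }
    ‖q‖ (fun h => BoundedContinuousFunction.norm_ofNormedAddCommGroup_le _ (by positivity)
      (fun x => (q.le_opNorm _).trans (by gcongr with i; exact (h i).norm_coe_le_norm x)))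

lemma pointwiseMultilinear_apply {k : ℕ} (q : ContinuousMultilinearMap ℂ (fun _ : Fin k => V) ℂ)
    (h : Fin k → X →ᵇ V) (x : X) : pointwiseMultilinear X q h x = q fun i => h i x := rfl

lemma norm_pointwiseMultilinear_le {k : ℕ}
    (q : ContinuousMultilinearMap ℂ (fun _ : Fin k => V) ℂ) :
    ‖pointwiseMultilinear X q‖ ≤ ‖q‖ :=
  by
  refine ContinuousMultilinearMap.opNorm_le_bound (norm_nonneg _) fun h => ?_
  rw [BoundedContinuousFunction.norm_le (by positivity)]
  intro x
  rw [pointwiseMultilinear_apply]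
  exact (q.le_opNorm _).trans (by gcongr with i; exact (h i).norm_coe_le_norm x)

/-- If `f` is analytic at `v`, the superposition operator `h ↦ f (v + h)` is analytic on a ball of
the space of bounded continuous functions. -/
lemma AnalyticAt.exists_superposition {f : V → ℂ} {v : V} (hf : AnalyticAt ℂ f v)
    (X : Type*) [TopologicalSpace X] :
    ∃ r : ℝ, 0 < r ∧ ∃ Φ : (X →ᵇ V) → (X →ᵇ ℂ),
      AnalyticOnNhd ℂ Φ (Metric.ball 0 r) ∧
      ∀ h ∈ Metric.ball (0 : X →ᵇ V) r, ∀ x, Φ h x = f (v + h x) := by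
  obtain ⟨p, R, hp⟩ := hf
  set P : FormalMultilinearSeries ℂ (X →ᵇ V) (X →ᵇ ℂ) := fun k => pointwiseMultilinear X (p k)
    with hP
  have hrad : p.radius ≤ P.radius := by
    refine ENNReal.le_of_forall_nnreal_lt fun r hr => ?_
    obtain ⟨C, -, hC⟩ := p.norm_mul_pow_le_of_lt_radius hr
    refine P.le_radius_of_bound C fun n => le_trans ?_ (hC n)
    gcongr
    exact norm_pointwiseMultilinear_le _
  have hPpos : 0 < P.radius := hp.r_pos.trans_le (hp.r_le.trans hrad)
  obtain ⟨r, hr0, hrR⟩ := ENNReal.lt_iff_exists_nnreal_btwn.1 hp.r_pos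
  have hr0' : (0 : ℝ) < r := by exact_mod_cast hr0
  have hball : Metric.ball (0 : X →ᵇ V) r ⊆ Metric.eball 0 P.radius := by
    intro h hh
    rw [Metric.mem_eball]
    refine lt_of_lt_of_le ?_ ((hrR.le.trans hp.r_le).trans hrad)
    rw [edist_dist, ENNReal.ofReal_lt_iff_lt_toReal dist_nonneg (by simp)]
    simpa using hh
  refine ⟨r, hr0', P.sum, ?_, ?_⟩
  · exact (P.hasFPowerSeriesOnBall hPpos).analyticOnNhd.mono hball
  · intro h hh x
    have h1 := P.hasSum (hball hh)
    have h2 := (BoundedContinuousFunction.evalCLM ℂ x).hasSum h1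
    have h3 : HasSum (fun n : ℕ => p n fun _ => h x) (f (v + h x)) := by
      apply hp.hasSum
      rw [Metric.mem_eball]
      refine lt_trans ?_ hrR
      rw [edist_dist, ENNReal.ofReal_lt_iff_lt_toReal dist_nonneg (by simp)]
      have : ‖h x‖ ≤ ‖h‖ := h.norm_coe_le_norm x
      have h4 : ‖h‖ < r := by simpa using hh
      simpa using this.trans_lt h4
    exact h2.unique h3

variable {E : Type*} [NormedAddCommGroup E] [NormedSpace ℂ E]

/-- Currying an analytic function into a local analytic family of bounded continuous functions. -/
lemma AnalyticAt.exists_curry {f : ℂ × E → ℂ} {t₀ : ℝ} {e₀ : E}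
    (hf : AnalyticAt ℂ f ((t₀ : ℂ), e₀)) :
    ∃ δ : ℝ, 0 < δ ∧ ∃ ψ : E → (ℝ →ᵇ ℂ), AnalyticAt ℂ ψ e₀ ∧
      ∀ᶠ e in 𝓝 e₀, ∀ t ∈ Set.Icc (t₀ - δ) (t₀ + δ), ψ e t = f ((t : ℂ), e) := by
  obtain ⟨r, hr, Φ, hΦ, hΦf⟩ := hf.exists_superposition ℝ
  set δ := r / 2 with hδ
  have hδ0 : 0 < δ := by positivity
  set c : ℝ → ℝ := fun t => max (-δ) (min δ (t - t₀)) with hc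
  have hcb : ∀ t, |c t| ≤ δ := fun t => abs_le.2
    ⟨le_max_left _ _, max_le (by linarith) (min_le_left _ _)⟩
  have hcc : Continuous c := by fun_prop
  set h₀ : ℝ →ᵇ ℂ × E := BoundedContinuousFunction.ofNormedAddCommGroup
    (fun t => ((c t : ℂ), (0 : E))) (by fun_prop) δ (fun t => by
      simp only [Prod.norm_mk, norm_zero, Complex.norm_real, Real.norm_eq_abs]
      exact max_le (hcb t) hδ0.le) with hh₀
  let L : E →L[ℂ] (ℝ →ᵇ ℂ × E) := LinearMap.mkContinuous
    { toFun := fun e => BoundedContinuousFunction.const ℝ ((0 : ℂ), e)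
      map_add' := fun x y => by ext t <;> simp
      map_smul' := fun a x => by ext t <;> simp } 1 (fun e => by
        rw [BoundedContinuousFunction.norm_le (by positivity)]
        intro t
        simp)
  have hLt : ∀ e t, L e t = ((0 : ℂ), e) := fun e t => rfl
  have hLn : ∀ e, ‖L e‖ ≤ ‖e‖ := fun e => by
    rw [BoundedContinuousFunction.norm_le (by positivity)]
    intro t
    simp [hLt]
  have hnorm : ∀ e ∈ Metric.ball e₀ δ, h₀ + L (e - e₀) ∈ Metric.ball (0 : ℝ →ᵇ ℂ × E) r := by
    intro e he
    rw [mem_ball_zero_iff]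
    have h1 : ‖h₀‖ ≤ δ := BoundedContinuousFunction.norm_ofNormedAddCommGroup_le _ hδ0.le _
    have h2 : ‖L (e - e₀)‖ < δ := (hLn _).trans_lt (by simpa [dist_eq_norm] using he)
    calc _ ≤ ‖h₀‖ + ‖L (e - e₀)‖ := norm_add_le _ _
      _ < r := by linarith
  refine ⟨δ, hδ0, fun e => Φ (h₀ + L (e - e₀)), ?_, ?_⟩
  · have h1 : AnalyticAt ℂ Φ (h₀ + L (e₀ - e₀)) := hΦ _ (hnorm e₀ (Metric.mem_ball_self hδ0))
    refine h1.comp_of_eq (f := fun e => h₀ + L (e - e₀)) ?_ rfl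
    exact analyticAt_const.add ((L.analyticAt _).comp (analyticAt_id.sub analyticAt_const))
  · filter_upwards [Metric.ball_mem_nhds e₀ hδ0] with e he t ht
    rw [hΦf _ (hnorm e he) t]
    have : c t = t - t₀ := by
      simp only [hc]
      rw [min_eq_right (by linarith [ht.2]), max_eq_right (by linarith [ht.1])]
    congr 1
    ext
    · simp [hh₀, hLt, this]
    · simp [hh₀, hLt]

end Superposition

section WeightedIntegral

open BoundedContinuousFunction
open scoped Topology

/-- Pairing of bounded continuous functions with a fixed integrable weight. -/
def weightPairing (μ : Measure ℝ) (k : ℝ → ℂ) : (ℝ →ᵇ ℂ) →L[ℂ] ℂ :=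
  if hk : Integrable k μ then
    LinearMap.mkContinuous
      { toFun := fun φ => ∫ t, k t * φ t ∂μ
        map_add' := fun φ ψ => by
          have h : ∀ φ : ℝ →ᵇ ℂ, Integrable (fun t => k t * φ t) μ := fun φ =>
            hk.mul_bdd (c := ‖φ‖) φ.continuous.aestronglyMeasurable (.of_forall φ.norm_coe_le_norm)
          simp only [BoundedContinuousFunction.coe_add, Pi.add_apply, mul_add]
          exact integral_add (h φ) (h ψ)
        map_smul' := fun c φ => by
          simp only [BoundedContinuousFunction.coe_smul, smul_eq_mul, RingHom.id_apply]
          rw [← integral_const_mul]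
          congr 1; ext t; ring }
      (∫ t, ‖k t‖ ∂μ) (fun φ => by
        refine (norm_integral_le_of_norm_le (hk.norm.mul_const ‖φ‖) (.of_forall fun t => ?_)).trans
          (integral_mul_const _ _).le
        rw [norm_mul]
        gcongr
        exact φ.norm_coe_le_norm t)
  else 0

lemma weightPairing_apply {μ : Measure ℝ} {k : ℝ → ℂ} (hk : Integrable k μ) (φ : ℝ →ᵇ ℂ) :
    weightPairing μ k φ = ∫ t, k t * φ t ∂μ := by
  simp [weightPairing, hk]

lemma integrable_weight_mul {μ : Measure ℝ} {k : ℝ → ℂ} (hk : Integrable k μ) (φ : ℝ →ᵇ ℂ) :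
    Integrable (fun t => k t * φ t) μ :=
  hk.mul_bdd (c := ‖φ‖) φ.continuous.aestronglyMeasurable (.of_forall φ.norm_coe_le_norm)

lemma integrableOn_rpow_Ioo {x : ℝ} (hx : 0 < x) :
    IntegrableOn (fun t : ℝ => t ^ (x - 1)) (Set.Ioo 0 1) := by
  rw [← intervalIntegrable_iff_integrableOn_Ioo_of_le zero_le_one]
  exact intervalIntegral.intervalIntegrable_rpow' (by linarith)

lemma integrableOn_cpow_Ioo {z : ℂ} (hz : 0 < z.re) :
    IntegrableOn (fun t : ℝ => (t : ℂ) ^ (z - 1)) (Set.Ioo 0 1) := by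
  rw [← intervalIntegrable_iff_integrableOn_Ioo_of_le zero_le_one]
  exact intervalIntegral.intervalIntegrable_cpow' (by simpa using hz)

lemma abs_log_le_rpow {t δ : ℝ} (ht : t ∈ Set.Ioo (0 : ℝ) 1) (hδ : 0 < δ) :
    |Real.log t| ≤ δ⁻¹ * t ^ (-δ) := by
  have h := (Real.abs_log_mul_self_rpow_lt t δ ht.1 ht.2.le hδ).le
  have hp : 0 < t ^ δ := Real.rpow_pos_of_pos ht.1 _
  rw [abs_mul, abs_of_pos hp] at h
  rw [Real.rpow_neg ht.1.le, ← div_eq_mul_inv, le_div_iff₀ hp]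
  simpa using h

lemma norm_cpow_taylor_le {z h : ℂ} {δ t : ℝ} (hδ : 0 < δ) (hh : ‖h‖ ≤ δ)
    (ht : t ∈ Set.Ioo (0 : ℝ) 1) :
    ‖(t : ℂ) ^ (z + h - 1) - (t : ℂ) ^ (z - 1) - h * ((Real.log t : ℂ) * (t : ℂ) ^ (z - 1))‖ ≤
      ‖h‖ ^ 2 * ((δ⁻¹) ^ 2 * t ^ (z.re - 3 * δ - 1)) := by
  have ht0 : (t : ℂ) ≠ 0 := by exact_mod_cast ht.1.ne'
  have e1 : (t : ℂ) ^ (z + h - 1) = (t : ℂ) ^ (z - 1) * Complex.exp (h * Real.log t) := by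
    rw [show z + h - 1 = (z - 1) + h by ring, Complex.cpow_add _ _ ht0,
      Complex.cpow_def_of_ne_zero ht0 h, Complex.ofReal_log ht.1.le, mul_comm h]
  have e2 : (t : ℂ) ^ (z + h - 1) - (t : ℂ) ^ (z - 1)
      - h * ((Real.log t : ℂ) * (t : ℂ) ^ (z - 1)) =
      (t : ℂ) ^ (z - 1) * (Complex.exp (h * Real.log t) - 1 - h * Real.log t) := by
    rw [e1]; ring
  have hl := abs_log_le_rpow ht hδ
  have hlog : Real.log t < 0 := Real.log_neg ht.1 ht.2
  have e3 : ‖Complex.exp (h * Real.log t) - 1 - h * Real.log t‖ ≤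
      (‖h‖ * (δ⁻¹ * t ^ (-δ))) ^ 2 * t ^ (-δ) := by
    have h1 := Complex.norm_exp_sub_sum_le_norm_mul_exp (h * Real.log t) 2
    simp only [Finset.sum_range_succ, Finset.sum_range_zero, pow_zero, pow_one, Nat.factorial,
      Nat.cast_one, div_one, zero_add, norm_mul, Complex.norm_real, Real.norm_eq_abs,
      mul_one] at h1
    rw [← sub_sub] at h1
    refine h1.trans ?_
    gcongr
    rw [Real.rpow_def_of_pos ht.1, abs_of_neg hlog]
    apply Real.exp_le_exp.2
    nlinarith
  have hn : ‖(t : ℂ) ^ (z - 1)‖ = t ^ (z.re - 1) := by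
    rw [Complex.norm_cpow_eq_rpow_re_of_pos ht.1]; simp
  rw [e2, norm_mul, hn]
  calc t ^ (z.re - 1) * ‖Complex.exp (h * Real.log t) - 1 - h * Real.log t‖
      ≤ t ^ (z.re - 1) * ((‖h‖ * (δ⁻¹ * t ^ (-δ))) ^ 2 * t ^ (-δ)) := by
        have : 0 ≤ t ^ (z.re - 1) := (Real.rpow_pos_of_pos ht.1 _).le
        gcongr
    _ = ‖h‖ ^ 2 * ((δ⁻¹) ^ 2 * (t ^ (z.re - 1) * t ^ (-δ) * t ^ (-δ) * t ^ (-δ))) := by ring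
    _ = _ := by
        rw [← Real.rpow_add ht.1, ← Real.rpow_add ht.1, ← Real.rpow_add ht.1]
        congr 3; ring

lemma integrableOn_log_mul_cpow {z : ℂ} (hz : 0 < z.re) :
    IntegrableOn (fun t : ℝ => (Real.log t : ℂ) * (t : ℂ) ^ (z - 1)) (Set.Ioo 0 1) := by
  have h0 : 0 < z.re / 2 := by positivity
  refine Integrable.mono' ((integrableOn_rpow_Ioo h0).const_mul (z.re / 2)⁻¹) ?_ ?_
  · apply AEStronglyMeasurable.mul
    · exact (Complex.measurable_ofReal.comp Real.measurable_log).aestronglyMeasurable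
    · exact (integrableOn_cpow_Ioo hz).aestronglyMeasurable
  · refine (ae_restrict_iff' measurableSet_Ioo).2 (.of_forall fun t ht => ?_)
    rw [norm_mul, Complex.norm_real, Real.norm_eq_abs, Complex.norm_cpow_eq_rpow_re_of_pos ht.1]
    calc _ ≤ ((z.re / 2)⁻¹ * t ^ (-(z.re / 2))) * t ^ (z - 1).re := by
          have : 0 ≤ t ^ (z - 1).re := (Real.rpow_pos_of_pos ht.1 _).le
          gcongr
          exact abs_log_le_rpow ht h0
      _ = _ := by
          rw [mul_assoc, ← Real.rpow_add ht.1]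
          congr 2
          simp
          ring

/-- Mellin weights on the unit interval depend analytically on the exponent, as functionals. -/
lemma analyticAt_weightPairing {A : Set ℝ} (hAm : MeasurableSet A) (hA : A ⊆ Set.Ioo 0 1) {z₀ : ℂ}
    (hz₀ : 0 < z₀.re) :
    AnalyticAt ℂ (fun z : ℂ => weightPairing (volume.restrict A) fun t => (t : ℂ) ^ (z - 1))
      z₀ := by
  rw [analyticAt_iff_eventually_differentiableAt]
  filter_upwards [(isOpen_lt continuous_const Complex.continuous_re).mem_nhds hz₀] with z hz
  have hz : 0 < z.re := hz
  set δ := z.re / 4 with hδ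
  have hδ0 : 0 < δ := by positivity
  have hint : ∀ {z : ℂ}, 0 < z.re → Integrable (fun t : ℝ => (t : ℂ) ^ (z - 1))
      (volume.restrict A) := fun h => (integrableOn_cpow_Ioo h).mono_set hA
  have hint' := (integrableOn_log_mul_cpow hz).mono_set hA
  have hb : IntegrableOn (fun t : ℝ => (δ⁻¹) ^ 2 * t ^ (z.re - 3 * δ - 1)) A :=
    ((integrableOn_rpow_Ioo (x := z.re - 3 * δ)
      (by simp only [hδ]; linarith)).mono_set hA).const_mul _
  set C := ∫ t in A, (δ⁻¹) ^ 2 * t ^ (z.re - 3 * δ - 1) with hC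
  refine HasDerivAt.differentiableAt (f' := weightPairing (volume.restrict A)
    fun t => (Real.log t : ℂ) * (t : ℂ) ^ (z - 1)) ?_
  rw [hasDerivAt_iff_isLittleO_nhds_zero]
  have hO : (fun h : ℂ => h ^ 2) =o[𝓝 0] fun h : ℂ => h := by
    simpa using Asymptotics.isLittleO_pow_pow (𝕜 := ℂ) (m := 1) (n := 2) (by norm_num)
  refine Asymptotics.IsBigO.trans_isLittleO ?_ hO
  refine Asymptotics.IsBigO.of_bound C ?_
  filter_upwards [Metric.ball_mem_nhds (0 : ℂ) hδ0] with h hh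
  have hh : ‖h‖ < δ := by simpa using hh
  have hzh : 0 < (z + h).re := by
    have := (Complex.abs_re_le_norm h).trans hh.le
    have := (abs_le.1 this).1
    simp only [Complex.add_re]; linarith
  have hC0 : 0 ≤ C := setIntegral_nonneg hAm fun t ht => by
    have := (hA ht).1
    positivity
  refine ContinuousLinearMap.opNorm_le_bound _ (by positivity) fun φ => ?_
  simp only [_root_.sub_apply, _root_.smul_apply, smul_eq_mul]
  rw [weightPairing_apply (hint hzh), weightPairing_apply (hint hz), weightPairing_apply hint',
    ← integral_const_mul, ← integral_sub (integrable_weight_mul (hint hzh) φ)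
      (integrable_weight_mul (hint hz) φ), ← integral_sub]
  · have : C * ‖h ^ 2‖ * ‖φ‖ =
        ∫ t in A, ‖h‖ ^ 2 * ((δ⁻¹) ^ 2 * t ^ (z.re - 3 * δ - 1)) * ‖φ‖ := by
      rw [integral_mul_const, integral_const_mul, norm_pow, mul_comm C]
    rw [this]
    refine norm_integral_le_of_norm_le ((hb.const_mul _).mul_const _) ?_
    refine (ae_restrict_iff' hAm).2 (.of_forall fun t ht => ?_)
    have e : (t : ℂ) ^ (z + h - 1) * φ t - (t : ℂ) ^ (z - 1) * φ t -
        h * ((Real.log t : ℂ) * (t : ℂ) ^ (z - 1) * φ t) =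
        ((t : ℂ) ^ (z + h - 1) - (t : ℂ) ^ (z - 1) -
          h * ((Real.log t : ℂ) * (t : ℂ) ^ (z - 1))) * φ t := by ring
    rw [e, norm_mul]
    have := (hA ht).1
    exact mul_le_mul (norm_cpow_taylor_le hδ0 hh.le (hA ht)) (φ.norm_coe_le_norm t)
      (norm_nonneg _) (by positivity)
  · exact (integrable_weight_mul (hint hzh) φ).sub (integrable_weight_mul (hint hz) φ)
  · exact (integrable_weight_mul hint' φ).const_mul _

variable {E : Type*} [NormedAddCommGroup E] [NormedSpace ℂ E]

lemma integrableOn_cpow_mul {z : ℂ} (hz : 0 < z.re) {φ : ℝ → ℂ}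
    (hφ : ContinuousOn φ (Set.Icc 0 1)) :
    IntegrableOn (fun t : ℝ => (t : ℂ) ^ (z - 1) * φ t) (Set.Ioo 0 1) := by
  obtain ⟨C, hC⟩ := isCompact_Icc.exists_bound_of_continuousOn hφ
  refine (integrableOn_cpow_Ioo hz).mul_bdd (c := C)
    ((hφ.mono Set.Ioo_subset_Icc_self).aestronglyMeasurable measurableSet_Ioo) ?_
  exact (ae_restrict_iff' measurableSet_Ioo).2
    (.of_forall fun t ht => hC t (Set.Ioo_subset_Icc_self ht))

lemma continuousOn_slice {f : ℂ × E → ℂ} {e : E}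
    (hf : ∀ t ∈ Set.Icc (0 : ℝ) 1, AnalyticAt ℂ f ((t : ℂ), e)) :
    ContinuousOn (fun t : ℝ => f ((t : ℂ), e)) (Set.Icc 0 1) := fun t ht =>
  ((hf t ht).continuousAt.comp (f := fun t : ℝ => ((t : ℂ), e))
    (by fun_prop)).continuousWithinAt

lemma eventually_analyticAt_slice {f : ℂ × E → ℂ} {e₀ : E}
    (hf : ∀ t ∈ Set.Icc (0 : ℝ) 1, AnalyticAt ℂ f ((t : ℂ), e₀)) :
    ∀ᶠ e in 𝓝 e₀, ∀ t ∈ Set.Icc (0 : ℝ) 1, AnalyticAt ℂ f ((t : ℂ), e) := by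
  refine isCompact_Icc.eventually_forall_of_forall_eventually fun t ht => ?_
  have h1 : ContinuousAt (fun p : E × ℝ => ((p.2 : ℂ), p.1)) (e₀, t) := by fun_prop
  exact h1.eventually (hf t ht).eventually_analyticAt

/-- Mellin-type integrals over the unit interval of an analytic family are analytic. -/
lemma analyticAt_integral_cpow_mul {f : ℂ × E → ℂ} {z₀ : ℂ} {e₀ : E} (hz₀ : 0 < z₀.re)
    (hf : ∀ t ∈ Set.Icc (0 : ℝ) 1, AnalyticAt ℂ f ((t : ℂ), e₀)) :
    AnalyticAt ℂ (fun p : ℂ × E => ∫ t in Set.Ioo (0 : ℝ) 1,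
      (t : ℂ) ^ (p.1 - 1) * f ((t : ℂ), p.2)) (z₀, e₀) := by
  have hev : ∀ᶠ p : ℂ × E in 𝓝 (z₀, e₀), IntegrableOn (fun t : ℝ =>
      (t : ℂ) ^ (p.1 - 1) * f ((t : ℂ), p.2)) (Set.Ioo 0 1) := by
    filter_upwards [continuousAt_fst.eventually
      ((isOpen_lt continuous_const Complex.continuous_re).mem_nhds hz₀),
      continuousAt_snd.eventually (eventually_analyticAt_slice hf)] with p hp1 hp2
    exact integrableOn_cpow_mul hp1 (continuousOn_slice hp2)
  let Q : Set ℝ → Prop := fun S => ∃ S' : Set ℝ, MeasurableSet S' ∧ S ⊆ S' ∧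
    ∀ A, MeasurableSet A → A ⊆ S' ∩ Set.Ioo 0 1 → AnalyticAt ℂ (fun p : ℂ × E =>
      ∫ t in A, (t : ℂ) ^ (p.1 - 1) * f ((t : ℂ), p.2)) (z₀, e₀)
  have hQ : Q (Set.Icc 0 1) := by
    refine isCompact_Icc.induction_on (p := Q) ?_ ?_ ?_ ?_
    · refine ⟨∅, MeasurableSet.empty, le_rfl, fun A _ hA => ?_⟩
      have : A = ∅ := by simpa using hA
      subst this
      simpa using analyticAt_const
    · rintro s t hst ⟨S', h1, h2, h3⟩
      exact ⟨S', h1, hst.trans h2, h3⟩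
    · rintro s t ⟨S, hS, hsS, hSA⟩ ⟨T, hT, htT, hTA⟩
      refine ⟨S ∪ T, hS.union hT, Set.union_subset_union hsS htT, fun A hAm hA => ?_⟩
      have h1 := hSA (A ∩ S) (hAm.inter hS) (fun x hx => ⟨hx.2, (hA hx.1).2⟩)
      have h2 := hTA (A \ S) (hAm.diff hS)
        (fun x hx => ⟨(hA hx.1).1.resolve_left hx.2, (hA hx.1).2⟩)
      refine (h1.add h2).congr ?_
      filter_upwards [hev] with p hp
      exact integral_inter_add_sdiff hS (hp.mono_set fun x hx => (hA hx).2)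
    · intro t₀ ht₀
      obtain ⟨δ, hδ, ψ, hψ, hψf⟩ := (hf t₀ ht₀).exists_curry
      refine ⟨Set.Icc (t₀ - δ) (t₀ + δ), mem_nhdsWithin_of_mem_nhds
        (Icc_mem_nhds (by linarith) (by linarith)), _, measurableSet_Icc, le_rfl,
        fun A hAm hA => ?_⟩
      have hA1 : A ⊆ Set.Ioo 0 1 := fun x hx => (hA hx).2
      have h1 : AnalyticAt ℂ (fun p : ℂ × E => weightPairing (volume.restrict A)
          (fun t => (t : ℂ) ^ (p.1 - 1))) (z₀, e₀) :=
        (analyticAt_weightPairing hAm hA1 hz₀).comp_of_eq analyticAt_fst rfl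
      have h2 : AnalyticAt ℂ (fun p : ℂ × E => ψ p.2) (z₀, e₀) :=
        hψ.comp_of_eq analyticAt_snd rfl
      have h3 := ((ContinuousLinearMap.id ℂ ((ℝ →ᵇ ℂ) →L[ℂ] ℂ)).analyticAt_bilinear
        (_, _)).comp_of_eq (h1.prod h2) rfl
      refine h3.congr ?_
      filter_upwards [continuousAt_fst.eventually
        ((isOpen_lt continuous_const Complex.continuous_re).mem_nhds hz₀),
        continuousAt_snd.eventually hψf] with p hp1 hp2
      have hp1 : 0 < p.1.re := hp1
      simp only [Function.comp, ContinuousLinearMap.id_apply]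
      rw [weightPairing_apply ((integrableOn_cpow_Ioo hp1).mono_set hA1)]
      refine setIntegral_congr_fun hAm fun t ht => ?_
      simp only [hp2 t (hA ht).1]
  obtain ⟨S', -, hS, hA⟩ := hQ
  exact hA _ measurableSet_Ioo fun x hx => ⟨hS (Set.Ioo_subset_Icc_self hx), hx⟩

end WeightedIntegral

section MellinContinuation

open scoped Topology

variable {E : Type*} [NormedAddCommGroup E] [NormedSpace ℂ E]

/-- The partial derivative with respect to the first variable. -/
def fstDeriv (f : ℂ × E → ℂ) : ℂ × E → ℂ := fun p => fderiv ℂ f p (1, 0)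

lemma AnalyticAt.fstDeriv {f : ℂ × E → ℂ} {p : ℂ × E} (hf : AnalyticAt ℂ f p) :
    AnalyticAt ℂ (fstDeriv f) p :=
  ((ContinuousLinearMap.apply ℂ ℂ ((1 : ℂ), (0 : E))).analyticAt _).comp hf.fderiv

lemma AnalyticAt.hasDerivAt_slice {f : ℂ × E → ℂ} {t : ℝ} {e : E}
    (hf : AnalyticAt ℂ f ((t : ℂ), e)) :
    HasDerivAt (fun t : ℝ => f ((t : ℂ), e)) (_root_.fstDeriv f ((t : ℂ), e)) t := by
  have h1 : HasDerivAt (fun t : ℝ => ((t : ℂ), e)) ((1 : ℂ), (0 : E)) t :=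
    (Complex.ofRealCLM.hasDerivAt (x := t)).prodMk (hasDerivAt_const t e)
  exact (hf.differentiableAt.hasFDerivAt.restrictScalars ℝ).comp_hasDerivAt t h1

/-- The regularised Mellin transform over the unit interval after `k` integrations by parts in the
first variable. -/
def mellinParts : ℕ → (ℂ × E → ℂ) → ℂ → E → ℂ
  | 0, f, z, e => (Gamma z)⁻¹ * ∫ t in Set.Ioo (0 : ℝ) 1, (t : ℂ) ^ (z - 1) * f ((t : ℂ), e)
  | k + 1, f, z, e => f (1, e) * (Gamma (z + 1))⁻¹ - mellinParts k (fstDeriv f) (z + 1) e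

lemma mul_integral_cpow_mul {f : ℂ × E → ℂ} {z : ℂ} {e : E} (hz : 0 < z.re)
    (hf : ∀ t ∈ Set.Icc (0 : ℝ) 1, AnalyticAt ℂ f ((t : ℂ), e)) :
    z * ∫ t in Set.Ioo (0 : ℝ) 1, (t : ℂ) ^ (z - 1) * f ((t : ℂ), e) =
      f (1, e) - ∫ t in Set.Ioo (0 : ℝ) 1, (t : ℂ) ^ (z + 1 - 1) * fstDeriv f ((t : ℂ), e) := by
  have hz0 : z ≠ 0 := by rintro rfl; simp at hz
  have hz1 : 0 < (z + 1).re := by simp; linarith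
  have hi1 := (integrableOn_cpow_mul hz (continuousOn_slice hf)).const_mul z
  have hi2 := integrableOn_cpow_mul hz1 (continuousOn_slice fun t ht => (hf t ht).fstDeriv)
  rw [eq_sub_iff_add_eq, ← integral_const_mul, ← integral_add hi1 hi2,
    ← integral_Ioc_eq_integral_Ioo, ← intervalIntegral.integral_of_le zero_le_one]
  rw [intervalIntegral.integral_eq_sub_of_hasDerivAt_of_le zero_le_one
    (f := fun t : ℝ => (t : ℂ) ^ z * f ((t : ℂ), e))]
  · simp [Complex.zero_cpow hz0]
  · exact (Complex.continuous_ofReal_cpow_const hz).continuousOn.mul (continuousOn_slice hf)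
  · intro t ht
    have h2 := hasDerivAt_ofReal_cpow_const (x := t) ht.1.ne' (r := z) hz0
    refine (h2.mul (hf t (Set.Ioo_subset_Icc_self ht)).hasDerivAt_slice).congr_deriv ?_
    rw [add_sub_cancel_right, mul_assoc]
  · rw [intervalIntegrable_iff_integrableOn_Ioo_of_le zero_le_one]
    exact hi1.add hi2

lemma mellinParts_succ {k : ℕ} {f : ℂ × E → ℂ} {z : ℂ} {e : E} (hz : -(k : ℝ) < z.re)
    (hf : ∀ t ∈ Set.Icc (0 : ℝ) 1, AnalyticAt ℂ f ((t : ℂ), e)) :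
    mellinParts (k + 1) f z e = mellinParts k f z e := by
  induction k generalizing f z with
  | zero =>
    have hz : 0 < z.re := by simpa using hz
    have hz0 : z ≠ 0 := by rintro rfl; simp at hz
    have hG := Gamma_ne_zero_of_re_pos hz
    have h := mul_integral_cpow_mul hz hf
    simp only [mellinParts]
    rw [Gamma_add_one z hz0, mul_inv]
    field_simp
    linear_combination -h
  | succ k ih =>
    have := ih (f := fstDeriv f) (z := z + 1) (by push_cast at hz; simp; linarith)
      fun t ht => (hf t ht).fstDeriv
    rw [mellinParts, this, ← mellinParts]

lemma mellinParts_add {k : ℕ} (l : ℕ) {f : ℂ × E → ℂ} {z : ℂ} {e : E} (hz : -(k : ℝ) < z.re)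
    (hf : ∀ t ∈ Set.Icc (0 : ℝ) 1, AnalyticAt ℂ f ((t : ℂ), e)) :
    mellinParts (k + l) f z e = mellinParts k f z e := by
  induction l with
  | zero => rfl
  | succ l ih =>
    rw [← ih, ← add_assoc]
    exact mellinParts_succ (by push_cast; linarith [l.cast_nonneg (α := ℝ)]) hf

lemma analyticAt_Gamma_inv (z : ℂ) : AnalyticAt ℂ (fun z => (Gamma z)⁻¹) z :=
  differentiable_one_div_Gamma.analyticAt z

lemma analyticAt_mellinParts {k : ℕ} {f : ℂ × E → ℂ} {z₀ : ℂ} {e₀ : E} (hz : -(k : ℝ) < z₀.re)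
    (hf : ∀ t ∈ Set.Icc (0 : ℝ) 1, AnalyticAt ℂ f ((t : ℂ), e₀)) :
    AnalyticAt ℂ (fun p : ℂ × E => mellinParts k f p.1 p.2) (z₀, e₀) := by
  induction k generalizing f z₀ with
  | zero =>
    simp only [mellinParts]
    exact ((analyticAt_Gamma_inv z₀).comp_of_eq analyticAt_fst rfl).mul
      (analyticAt_integral_cpow_mul (by simpa using hz) hf)
  | succ k ih =>
    have h := ih (f := fstDeriv f) (z₀ := z₀ + 1) (by push_cast at hz; simp; linarith)
      fun t ht => (hf t ht).fstDeriv
    simp only [mellinParts]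
    have h1 : AnalyticAt ℂ f ((1 : ℂ), e₀) := by simpa using hf 1 (by simp)
    refine AnalyticAt.sub (.mul ?_ ?_) ?_
    · exact h1.comp_of_eq (f := fun p : ℂ × E => ((1 : ℂ), p.2))
        (analyticAt_const.prod analyticAt_snd) rfl
    · exact (analyticAt_Gamma_inv (z₀ + 1)).comp_of_eq (f := fun p : ℂ × E => p.1 + 1)
        (analyticAt_fst.add analyticAt_const) rfl
    · exact h.comp_of_eq (f := fun p : ℂ × E => (p.1 + 1, p.2))
        ((analyticAt_fst.add analyticAt_const).prod analyticAt_snd) rfl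

/-- The entire continuation of the regularised Mellin transform over the unit interval. -/
def mellinReg (f : ℂ × E → ℂ) (p : ℂ × E) : ℂ := mellinParts (⌈-p.1.re⌉₊ + 1) f p.1 p.2

lemma mellinReg_eq {f : ℂ × E → ℂ} {z : ℂ} {e : E} {k : ℕ} (hz : -(k : ℝ) < z.re)
    (hf : ∀ t ∈ Set.Icc (0 : ℝ) 1, AnalyticAt ℂ f ((t : ℂ), e)) :
    mellinReg f (z, e) = mellinParts k f z e := by
  have h1 : -((⌈-z.re⌉₊ + 1 : ℕ) : ℝ) < z.re := by
    push_cast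
    linarith [Nat.le_ceil (-z.re)]
  rw [mellinReg, ← mellinParts_add k h1 hf, add_comm, mellinParts_add _ hz hf]

lemma mellinReg_eq_integral {f : ℂ × E → ℂ} {z : ℂ} {e : E} (hz : 0 < z.re)
    (hf : ∀ t ∈ Set.Icc (0 : ℝ) 1, AnalyticAt ℂ f ((t : ℂ), e)) :
    ∫ t in Set.Ioo (0 : ℝ) 1, (t : ℂ) ^ (z - 1) * f ((t : ℂ), e) =
      Gamma z * mellinReg f (z, e) := by
  rw [mellinReg_eq (k := 0) (by simpa using hz) hf, mellinParts,
    mul_inv_cancel_left₀ (Gamma_ne_zero_of_re_pos hz)]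

lemma analyticAt_mellinReg {f : ℂ × E → ℂ} {z₀ : ℂ} {e₀ : E}
    (hf : ∀ t ∈ Set.Icc (0 : ℝ) 1, AnalyticAt ℂ f ((t : ℂ), e₀)) :
    AnalyticAt ℂ (mellinReg f) (z₀, e₀) := by
  obtain ⟨k, hk⟩ := exists_nat_gt (-z₀.re)
  have hk : -(k : ℝ) < z₀.re := by linarith
  refine (analyticAt_mellinParts hk hf).congr ?_
  filter_upwards [continuousAt_fst.eventually
    ((isOpen_lt continuous_const Complex.continuous_re).mem_nhds hk),
    continuousAt_snd.eventually (eventually_analyticAt_slice hf)] with p hp1 hp2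
  exact (mellinReg_eq hp1 hp2).symm

end MellinContinuation

section Multivariate

open scoped Topology

lemma setIntegral_fin_cons {m : ℕ} {A : Set ℝ} {S : Set (Fin m → ℝ)} {f : (Fin (m + 1) → ℝ) → ℂ}
    (hf : IntegrableOn f {x : Fin (m + 1) → ℝ | x 0 ∈ A ∧ (fun j : Fin m => x j.succ) ∈ S}) :
    ∫ x in {x : Fin (m + 1) → ℝ | x 0 ∈ A ∧ (fun j : Fin m => x j.succ) ∈ S}, f x =
      ∫ y in S, ∫ t in A, f (Fin.cons t y) := by
  set e := (MeasurableEquiv.piFinSuccAbove (fun _ : Fin (m + 1) => ℝ) 0).symm with he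
  have mp : MeasurePreserving e :=
    (volume_preserving_piFinSuccAbove (fun _ : Fin (m + 1) => ℝ) 0).symm
  have hcons : ∀ p, e p = Fin.cons p.1 p.2 := fun p => by
    simp [he, MeasurableEquiv.piFinSuccAbove_symm_apply, Fin.insertNthEquiv]
  have hpre : e ⁻¹' {x : Fin (m + 1) → ℝ | x 0 ∈ A ∧ (fun j : Fin m => x j.succ) ∈ S} = A ×ˢ S := by
    ext p
    simp [hcons]
  have hint := (mp.integrableOn_comp_preimage e.measurableEmbedding).2 hf
  rw [← mp.setIntegral_preimage_emb e.measurableEmbedding, hpre]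
  rw [hpre] at hint
  rw [Measure.volume_eq_prod, ← Measure.prod_restrict] at *
  rw [IntegrableOn, ← Measure.prod_restrict] at hint
  rw [integral_prod_symm (fun p => f (e p)) hint]
  simp [hcons]

lemma integrableOn_pi_prod {ι : Type*} [Fintype ι] {S : ι → Set ℝ} {k : ι → ℝ → ℝ}
    (hk : ∀ j, IntegrableOn (k j) (S j)) :
    IntegrableOn (fun x : ι → ℝ => ∏ j, k j (x j)) (Set.univ.pi S) := by
  rw [IntegrableOn, volume_pi, Measure.restrict_pi_pi]
  exact Integrable.fintype_prod hk

lemma analyticAt_fin_cons {m : ℕ} {V : Type*} [NormedAddCommGroup V] [NormedSpace ℂ V]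
    {a : V → ℂ} {b : V → Fin m → ℂ} {v : V} (ha : AnalyticAt ℂ a v) (hb : AnalyticAt ℂ b v) :
    AnalyticAt ℂ (fun v => (Fin.cons (a v) (b v) : Fin (m + 1) → ℂ)) v := by
  rw [analyticAt_pi_iff]
  intro j
  refine Fin.cases ?_ (fun j => ?_) j
  · simpa using ha
  · simpa using analyticAt_pi_iff.1 hb j

lemma integrableOn_prod_cpow_mul {m : ℕ} {z : Fin m → ℂ} (hz : ∀ j, 0 < (z j).re)
    {φ : (Fin m → ℝ) → ℂ} (hφ : ContinuousOn φ (Set.univ.pi fun _ => Set.Icc 0 1)) :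
    IntegrableOn (fun σ : Fin m → ℝ => (∏ j, (σ j : ℂ) ^ (z j - 1)) * φ σ)
      (Set.univ.pi fun _ => Set.Ioo 0 1) := by
  have hsub : (Set.univ.pi fun _ : Fin m => Set.Ioo (0 : ℝ) 1) ⊆
      Set.univ.pi fun _ => Set.Icc 0 1 := Set.pi_mono fun _ _ => Set.Ioo_subset_Icc_self
  have hmeas : MeasurableSet (Set.univ.pi fun _ : Fin m => Set.Ioo (0 : ℝ) 1) :=
    MeasurableSet.univ_pi fun _ => measurableSet_Ioo
  obtain ⟨C, hC⟩ := (isCompact_univ_pi fun _ => isCompact_Icc).exists_bound_of_continuousOn hφ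
  refine Integrable.mul_bdd (c := C) ?_ ((hφ.mono hsub).aestronglyMeasurable hmeas)
    ((ae_restrict_iff' hmeas).2 (.of_forall fun t ht => hC t (hsub ht)))
  rw [volume_pi, Measure.restrict_pi_pi]
  exact Integrable.fintype_prod (f := fun j t => ((t : ℝ) : ℂ) ^ (z j - 1))
    fun j => integrableOn_cpow_Ioo (hz j)

/-- The regularised multivariate Mellin transform over the unit cube of an analytic family extends
analytically to all exponents. -/
theorem exists_mellin_continuation (m : ℕ) {E : Type} [NormedAddCommGroup E] [NormedSpace ℂ E]
    (U : Set E) (g : (Fin m → ℂ) × E → ℂ)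
    (hg : ∀ σ : Fin m → ℝ, (∀ j, σ j ∈ Set.Icc (0 : ℝ) 1) → ∀ e ∈ U,
      AnalyticAt ℂ g (fun j => (σ j : ℂ), e)) :
    ∃ F : (Fin m → ℂ) × E → ℂ, (∀ z, ∀ e ∈ U, AnalyticAt ℂ F (z, e)) ∧
      ∀ z : Fin m → ℂ, (∀ j, 0 < (z j).re) → ∀ e ∈ U,
        ∫ σ in Set.univ.pi fun _ : Fin m => Set.Ioo (0 : ℝ) 1,
          (∏ j, (σ j : ℂ) ^ (z j - 1)) * g (fun j => (σ j : ℂ), e) =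
        (∏ j, Gamma (z j)) * F (z, e) := by
  induction m generalizing E with
  | zero =>
    refine ⟨g, fun z e he => ?_, fun z _ e he => ?_⟩
    · have := hg (fun _ => 0) (fun j => j.elim0) e he
      rwa [Subsingleton.elim z (fun j => ((0 : ℝ) : ℂ))]
    · have : (Set.univ.pi fun _ : Fin 0 => Set.Ioo (0 : ℝ) 1) = Set.univ := by ext; simp
      rw [this]
      simp only [Finset.univ_eq_empty, Finset.prod_empty, one_mul, Measure.restrict_univ]
      rw [integral_unique]
      simp [Measure.real, volume_pi, Subsingleton.elim (_ : Fin 0 → ℂ) z]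
  | succ m ih =>
    let f : ℂ × ((Fin m → ℂ) × E) → ℂ := fun p => g (Fin.cons p.1 p.2.1, p.2.2)
    have hcast : ∀ (t : ℝ) (y : Fin m → ℝ),
        (fun j => (((Fin.cons t y : Fin (m + 1) → ℝ) j : ℝ) : ℂ)) =
          Fin.cons (t : ℂ) fun j => (y j : ℂ) := fun t y => by
      ext j
      refine Fin.cases ?_ (fun j => ?_) j <;> simp
    have hf : ∀ y : Fin m → ℝ, (∀ j, y j ∈ Set.Icc (0 : ℝ) 1) → ∀ e ∈ U,
        ∀ t ∈ Set.Icc (0 : ℝ) 1, AnalyticAt ℂ f ((t : ℂ), (fun j => (y j : ℂ)), e) := by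
      intro y hy e he t ht
      have h1 := hg (Fin.cons t y)
        (Fin.forall_fin_succ.2 ⟨by simpa using ht, by simpa using hy⟩) e he
      refine h1.comp_of_eq (f := fun p : ℂ × ((Fin m → ℂ) × E) =>
        ((Fin.cons p.1 p.2.1 : Fin (m + 1) → ℂ), p.2.2)) ?_ ?_
      · exact (analyticAt_fin_cons analyticAt_fst (analyticAt_fst.comp analyticAt_snd)).prod
          (analyticAt_snd.comp analyticAt_snd)
      · simp only [hcast]
    obtain ⟨F, hF, hFI⟩ := ih (E := ℂ × E) (Set.univ ×ˢ U)
      (fun p => mellinReg f (p.2.1, p.1, p.2.2)) (by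
        rintro y hy ⟨z, e⟩ ⟨-, he⟩
        refine (analyticAt_mellinReg (z₀ := z) (hf y hy e he)).comp_of_eq
          (f := fun p : (Fin m → ℂ) × (ℂ × E) => (p.2.1, p.1, p.2.2)) ?_ rfl
        exact (analyticAt_fst.comp analyticAt_snd).prod
          (analyticAt_fst.prod (analyticAt_snd.comp analyticAt_snd)))
    refine ⟨fun p => F ((fun j : Fin m => p.1 j.succ), p.1 0, p.2),
      fun z e he => ?_, fun z hz e he => ?_⟩
    · refine (hF (fun j : Fin m => z j.succ) (z 0, e) ⟨trivial, he⟩).comp_of_eq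
          (f := fun p : (Fin (m + 1) → ℂ) × E =>
            ((fun j : Fin m => p.1 j.succ), p.1 0, p.2)) ?_ rfl
      have hj : ∀ j, AnalyticAt ℂ (fun p : (Fin (m + 1) → ℂ) × E => p.1 j) (z, e) := fun j =>
        (analyticAt_pi_iff.1 analyticAt_fst j)
      exact (analyticAt_pi_iff.2 fun j : Fin m => hj j.succ).prod ((hj 0).prod analyticAt_snd)
    · have hcont : ContinuousOn (fun σ : Fin (m + 1) → ℝ => g (fun j => (σ j : ℂ), e))
          (Set.univ.pi fun _ => Set.Icc 0 1) := fun σ hσ =>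
        ((hg σ (fun j => hσ j trivial) e he).continuousAt.comp
          (f := fun σ : Fin (m + 1) → ℝ => ((fun j => (σ j : ℂ)), e))
          (Continuous.prodMk (continuous_pi fun j => continuous_ofReal.comp (continuous_apply j))
            continuous_const).continuousAt).continuousWithinAt
      have hint := integrableOn_prod_cpow_mul hz hcont
      have hset : (Set.univ.pi fun _ : Fin (m + 1) => Set.Ioo (0 : ℝ) 1) =
          {x : Fin (m + 1) → ℝ | x 0 ∈ Set.Ioo (0 : ℝ) 1 ∧
            (fun j : Fin m => x j.succ) ∈ Set.univ.pi fun _ : Fin m => Set.Ioo (0 : ℝ) 1} := by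
        ext x
        simp [Fin.forall_fin_succ]
      rw [hset] at hint ⊢
      rw [setIntegral_fin_cons hint]
      have h1 := hFI (fun j : Fin m => z j.succ) (fun j => hz j.succ) (z 0, e) ⟨trivial, he⟩
      rw [Fin.prod_univ_succ, mul_assoc]
      rw [← h1, ← integral_const_mul]
      refine setIntegral_congr_fun (MeasurableSet.univ_pi fun _ => measurableSet_Ioo)
        fun y hy => ?_
      have h2 := mellinReg_eq_integral (hz 0)
        (hf y (fun j => Set.Ioo_subset_Icc_self (hy j trivial)) e he)
      simp only [Fin.prod_univ_succ, Fin.cons_zero, Fin.cons_succ, hcast]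
      rw [mul_left_comm, ← h2, ← integral_const_mul]
      congr 1; ext t
      simp only [f]
      ring

end Multivariate

section ChainCoordinates

/-- The indices of the coordinates whose product is the `j`-th chain product. -/
def chainSet (Z : ℕ) {n : ℕ} (j : Fin n) : Finset (Fin n) :=
  Finset.univ.filter fun k => ((k : ℕ) ≤ Z ∧ k ≤ j) ∨ k = j

/-- The monomial substitution parametrising `deltaRegion`. -/
def chainProd {R : Type*} [CommMonoid R] (Z : ℕ) {n : ℕ} (x : Fin n → R) (j : Fin n) : R :=
  ∏ k ∈ chainSet Z j, x k

/-- The index preceding `j + 1` in the chain order defining `deltaRegion`. -/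
def chainPred (Z : ℕ) {m : ℕ} (j : Fin m) : Fin (m + 1) :=
  ⟨min j Z, by omega⟩

/-- The domain of the substitution `chainProd`. -/
def chainBox (m : ℕ) : Set (Fin (m + 1) → ℝ) :=
  {x | x 0 ∈ Set.Ioi (0 : ℝ) ∧
    (fun j : Fin m => x j.succ) ∈ Set.univ.pi fun _ : Fin m => Set.Ioo (0 : ℝ) 1}

lemma mem_chainSet {Z n : ℕ} {j k : Fin n} :
    k ∈ chainSet Z j ↔ ((k : ℕ) ≤ Z ∧ k ≤ j) ∨ k = j := by
  simp [chainSet]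

lemma self_mem_chainSet (Z : ℕ) {n : ℕ} (j : Fin n) : j ∈ chainSet Z j :=
  mem_chainSet.2 (Or.inr rfl)

lemma zero_mem_chainSet (Z : ℕ) {m : ℕ} (j : Fin (m + 1)) : 0 ∈ chainSet Z j :=
  mem_chainSet.2 (Or.inl ⟨Nat.zero_le _, Fin.zero_le _⟩)

lemma chainSet_subset {Z n : ℕ} {i j : Fin n} (hi : (i : ℕ) ≤ Z) (hij : i ≤ j) :
    chainSet Z i ⊆ chainSet Z j := by
  intro k hk
  simp only [mem_chainSet, Fin.le_def, Fin.ext_iff] at *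
  omega

lemma chainProd_zero {R : Type*} [CommMonoid R] (Z : ℕ) {m : ℕ} (x : Fin (m + 1) → R) :
    chainProd Z x 0 = x 0 := by
  have : chainSet Z (0 : Fin (m + 1)) = {0} := by
    ext k
    simp [mem_chainSet]
  simp [chainProd, this]

lemma chainProd_succ {R : Type*} [CommMonoid R] (Z : ℕ) {m : ℕ} (x : Fin (m + 1) → R)
    (j : Fin m) : chainProd Z x j.succ = x j.succ * chainProd Z x (chainPred Z j) := by
  have h : chainSet Z j.succ = insert j.succ (chainSet Z (chainPred Z j)) := by
    ext k
    simp only [Finset.mem_insert, mem_chainSet, chainPred, Fin.le_def, Fin.ext_iff, Fin.val_succ]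
    omega
  rw [chainProd, h, Finset.prod_insert, chainProd]
  simp only [mem_chainSet, chainPred, Fin.le_def, Fin.ext_iff, Fin.val_succ]
  omega

lemma chainProd_eq_mul {R : Type*} [CommMonoid R] {Z n : ℕ} (x : Fin n → R) {i j : Fin n}
    (hi : (i : ℕ) ≤ Z) (hij : i ≤ j) :
    chainProd Z x j = chainProd Z x i * ∏ k ∈ chainSet Z j \ chainSet Z i, x k := by
  rw [chainProd, chainProd, mul_comm, Finset.prod_sdiff (chainSet_subset hi hij)]

lemma pos_of_mem_chainBox {m : ℕ} {x : Fin (m + 1) → ℝ} (hx : x ∈ chainBox m) (k) : 0 < x k := by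
  refine Fin.cases hx.1 (fun k => (hx.2 k trivial).1) k

lemma chainProd_pos {m Z : ℕ} {x : Fin (m + 1) → ℝ} (hx : x ∈ chainBox m) (j) :
    0 < chainProd Z x j :=
  Finset.prod_pos fun k _ => pos_of_mem_chainBox hx k

lemma chainProd_lt {m Z : ℕ} {x : Fin (m + 1) → ℝ} (hx : x ∈ chainBox m) {i j : Fin (m + 1)}
    (hi : (i : ℕ) ≤ Z) (hij : i < j) : chainProd Z x j < chainProd Z x i := by
  rw [chainProd_eq_mul x hi hij.le]
  refine mul_lt_of_lt_one_right (chainProd_pos hx i) ?_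
  have hlt : ∀ k ∈ chainSet Z j \ chainSet Z i, x k < 1 := by
    intro k
    refine Fin.cases (fun h => ?_) (fun k _ => (hx.2 k trivial).2) k
    exact absurd (zero_mem_chainSet Z i) (Finset.mem_sdiff.1 h).2
  have hj : j ∈ chainSet Z j \ chainSet Z i := by
    refine Finset.mem_sdiff.2 ⟨self_mem_chainSet Z j, fun h => ?_⟩
    simp only [mem_chainSet, Fin.le_def, Fin.ext_iff, Fin.lt_def] at h hij
    omega
  calc _ < ∏ k ∈ chainSet Z j \ chainSet Z i, (1 : ℝ) :=
        Finset.prod_lt_prod (fun k _ => pos_of_mem_chainBox hx k) (fun k hk => (hlt k hk).le)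
          ⟨j, hj, hlt j hj⟩
    _ = 1 := by simp

lemma chainProd_div {m Z : ℕ} {T : Fin (m + 1) → ℝ} (hT : ∀ j, 0 < T j) :
    chainProd Z (Fin.cons (T 0) fun j : Fin m => T j.succ / T (chainPred Z j)) = T := by
  ext j
  induction h : (j : ℕ) using Nat.strong_induction_on generalizing j with
  | _ k ih =>
    subst h
    cases j using Fin.cases with
    | zero => simp [chainProd_zero]
    | succ j =>
      rw [chainProd_succ, ih _ (by simp [chainPred]) _ rfl]
      simp [(hT (chainPred Z j)).ne']

lemma image_chainProd (m Z : ℕ) :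
    chainProd Z '' chainBox m = deltaRegion (m + 1) Z := by
  ext T
  constructor
  · rintro ⟨x, hx, rfl⟩
    exact ⟨chainProd_pos hx, fun i j hij hj => chainProd_lt hx (by omega) hij,
      fun i l hi hl => chainProd_lt hx hi.le (by rw [Fin.lt_def]; omega)⟩
  · rintro ⟨h0, h1, h2⟩
    refine ⟨Fin.cons (T 0) fun j : Fin m => T j.succ / T (chainPred Z j), ⟨h0 0, fun j _ => ?_⟩,
      chainProd_div h0⟩
    simp only [Fin.cons_succ]
    refine ⟨div_pos (h0 _) (h0 _), (div_lt_one (h0 _)).2 ?_⟩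
    by_cases hj : (j : ℕ) < Z
    · exact h1 _ _ (by simp [chainPred]) (by simpa using hj)
    · exact h2 _ _ (by simpa [chainPred] using hj) (by simp; omega)

lemma injOn_chainProd (m Z : ℕ) : Set.InjOn (chainProd (R := ℝ) Z) (chainBox m) := by
  intro x hx y hy h
  ext j
  refine Fin.cases ?_ (fun j => ?_) j
  · simpa [chainProd_zero] using congrFun h 0
  · have h1 := congrFun h j.succ
    rw [chainProd_succ, chainProd_succ, h] at h1
    exact mul_right_cancel₀ (chainProd_pos hy _).ne' h1

lemma measurableSet_chainBox (m : ℕ) : MeasurableSet (chainBox m) := by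
  refine (measurableSet_Ioi.preimage (measurable_pi_apply 0)).inter
    ((MeasurableSet.univ_pi fun _ => measurableSet_Ioo).preimage ?_)
  exact measurable_pi_lambda _ fun j => measurable_pi_apply _

/-- The derivative of `chainProd`. -/
def chainDeriv (Z : ℕ) {n : ℕ} (x : Fin n → ℝ) : (Fin n → ℝ) →L[ℝ] (Fin n → ℝ) :=
  ContinuousLinearMap.pi fun j => ∑ k ∈ chainSet Z j,
    (∏ l ∈ (chainSet Z j).erase k, x l) • ContinuousLinearMap.proj k

lemma hasFDerivAt_chainProd (Z : ℕ) {n : ℕ} (x : Fin n → ℝ) :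
    HasFDerivAt (chainProd Z) (chainDeriv Z x) x := by
  rw [hasFDerivAt_pi']
  intro j
  exact HasFDerivAt.finsetProd fun k _ => hasFDerivAt_apply k x

lemma det_chainDeriv (Z : ℕ) {n : ℕ} (x : Fin n → ℝ) :
    (chainDeriv Z x).det = ∏ j, ∏ k ∈ (chainSet Z j).erase j, x k := by
  have hentry : ∀ j k, LinearMap.toMatrix' (chainDeriv Z x : (Fin n → ℝ) →ₗ[ℝ] (Fin n → ℝ)) j k =
      if k ∈ chainSet Z j then ∏ l ∈ (chainSet Z j).erase k, x l else 0 := by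
    intro j k
    simp [LinearMap.toMatrix'_apply, chainDeriv, Pi.single_apply]
  rw [ContinuousLinearMap.det, ← LinearMap.det_toMatrix', Matrix.det_of_isLowerTriangular]
  · exact Finset.prod_congr rfl fun j _ => by rw [hentry, if_pos (self_mem_chainSet Z j)]
  · intro j k hjk
    rw [hentry, if_neg]
    have : j < k := hjk
    simp only [mem_chainSet, Fin.le_def, Fin.ext_iff, Fin.lt_def] at this ⊢
    omega

lemma setIntegral_deltaRegion {m Z : ℕ} (f : (Fin (m + 1) → ℝ) → ℂ) :
    ∫ T in deltaRegion (m + 1) Z, f T =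
      ∫ x in chainBox m, (((∏ j, chainProd Z x j) / ∏ j, x j : ℝ) : ℂ) * f (chainProd Z x) := by
  rw [← image_chainProd m Z, integral_image_eq_integral_abs_det_fderiv_smul volume
    (measurableSet_chainBox m) (fun x _ => (hasFDerivAt_chainProd Z x).hasFDerivWithinAt)
    (injOn_chainProd m Z)]
  refine setIntegral_congr_fun (measurableSet_chainBox m) fun x hx => ?_
  have hpos := pos_of_mem_chainBox hx
  have hdet : |(chainDeriv Z x).det| = (∏ j, chainProd Z x j) / ∏ j, x j := by
    rw [det_chainDeriv, abs_of_pos (Finset.prod_pos fun j _ => Finset.prod_pos fun k _ => hpos k),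
      eq_div_iff (Finset.prod_pos fun j _ => hpos j).ne', ← Finset.prod_mul_distrib]
    exact Finset.prod_congr rfl fun j _ => Finset.prod_erase_mul _ _ (self_mem_chainSet Z j)
  simp only [hdet, real_smul]

end ChainCoordinates

section Integrand

variable {N n : ℕ}

/-- The sum `∑ j, a i j * T j` with its leading chain product divided out, as a function of the
chain coordinates. -/
def rowFactor (a : Fin N → Fin n → ℂ) (Z : ℕ) (f : Fin N → Fin n) (x : Fin n → ℂ)
    (i : Fin N) : ℂ :=
  ∑ j, a i j * ∏ k ∈ chainSet Z j \ chainSet Z (f i), x k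

/-- `f i` is the column of the first non-vanishing entry of row `i`, and is at most `Z`. -/
def IsLeading (a : Fin N → Fin n → ℂ) (Z : ℕ) (f : Fin N → Fin n) : Prop :=
  ∀ i, (f i : ℕ) ≤ Z ∧ a i (f i) ≠ 0 ∧ ∀ k < f i, a i k = 0

lemma exists_isLeading {a : Fin N → Fin n → ℂ} {Z : ℕ} (hH : HypH a)
    (hrow : ∀ i, (Finset.univ.filter fun j => a i j = 0).card ≤ Z) : ∃ f, IsLeading a Z f := by
  suffices h : ∀ i, ∃ j : Fin n, (j : ℕ) ≤ Z ∧ a i j ≠ 0 ∧ ∀ k < j, a i k = 0 by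
    choose f hf using h
    exact ⟨f, hf⟩
  intro i
  have hne : (Finset.univ.filter fun j => a i j ≠ 0).Nonempty := by
    obtain ⟨j, hj⟩ := hH.2 i
    exact ⟨j, by simpa using hj⟩
  have hlt : ∀ k < (Finset.univ.filter fun j => a i j ≠ 0).min' hne, a i k = 0 := by
    intro k hk
    by_contra h
    exact absurd (Finset.min'_le _ k (by simpa using h)) (not_le.2 hk)
  refine ⟨_, ?_, (Finset.mem_filter.1 (Finset.min'_mem _ hne)).2, hlt⟩
  refine le_trans ?_ (hrow i)
  rw [← Fin.card_Iio]
  exact Finset.card_le_card fun k hk => by simpa using hlt k (Finset.mem_Iio.1 hk)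

lemma mem_Fj_iff {a : Fin N → Fin n → ℂ} {Z : ℕ} {f : Fin N → Fin n} (hf : IsLeading a Z f)
    {i : Fin N} {j : Fin n} : i ∈ Fj a j ↔ f i = j := by
  simp only [Fj, Finset.mem_filter, Finset.mem_univ, true_and, ← Fin.lt_def]
  constructor
  · rintro ⟨h1, h2⟩
    exact le_antisymm (not_lt.1 fun h => h2 ((hf i).2.2 j h))
      (not_lt.1 fun h => (hf i).2.1 (h1 _ h))
  · rintro rfl
    exact ⟨(hf i).2.2, (hf i).2.1⟩

lemma sum_mul_chainProd {a : Fin N → Fin n → ℂ} {Z : ℕ} {f : Fin N → Fin n}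
    (hf : IsLeading a Z f) (x : Fin n → ℂ) (i : Fin N) :
    ∑ j, a i j * chainProd Z x j = chainProd Z x (f i) * rowFactor a Z f x i := by
  rw [rowFactor, Finset.mul_sum]
  refine Finset.sum_congr rfl fun j _ => ?_
  by_cases hj : j < f i
  · simp [(hf i).2.2 j hj]
  · rw [chainProd_eq_mul x (hf i).1 (not_lt.1 hj)]
    ring

lemma sj_eq {a : Fin N → Fin n → ℂ} {Z : ℕ} {f : Fin N → Fin n} (hf : IsLeading a Z f)
    (s : ℂ) (k : Fin n) :
    sj a Z s k = ((Finset.univ.filter fun j => k ∈ chainSet Z j).card : ℂ) * s -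
      ((Finset.univ.filter fun i => k ∈ chainSet Z (f i)).card : ℂ) := by
  by_cases hk : (k : ℕ) ≤ Z
  · have h1 : (Finset.univ.filter fun j => k ∈ chainSet Z j) = Finset.Ici k := by
      ext j
      simp only [Finset.mem_filter, Finset.mem_univ, true_and, Finset.mem_Ici, mem_chainSet,
        Fin.le_def, Fin.ext_iff]
      omega
    have h2 : (Finset.univ.filter fun i => k ∈ chainSet Z (f i)) =
        (Finset.univ.filter (fun l : Fin n => (k : ℕ) ≤ (l : ℕ) ∧ (l : ℕ) ≤ Z)).biUnion (Fj a) := by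
      ext i
      have := (hf i).1
      simp only [Finset.mem_filter, Finset.mem_univ, true_and, Finset.mem_biUnion, mem_chainSet,
        mem_Fj_iff hf, exists_eq_right']
      simp only [Fin.le_def, Fin.ext_iff]
      omega
    have h3 : (((Finset.univ.filter fun j => k ∈ chainSet Z j).card : ℕ) : ℂ) = n - (k : ℕ) := by
      rw [h1, Fin.card_Ici, Nat.cast_sub k.2.le]
    rw [sj, if_pos hk, h3, h2, Finset.card_biUnion]
    · push_cast
      rfl
    · intro l _ l' _ hne
      rw [Function.onFun, Finset.disjoint_left]
      intro i hi hi'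
      exact hne (((mem_Fj_iff hf).1 hi).symm.trans ((mem_Fj_iff hf).1 hi'))
  · have h1 : (Finset.univ.filter fun j => k ∈ chainSet Z j) = {k} := by
      ext j
      simp only [Finset.mem_filter, Finset.mem_univ, true_and, Finset.mem_singleton, mem_chainSet,
        Fin.le_def, Fin.ext_iff]
      omega
    have h2 : (Finset.univ.filter fun i => k ∈ chainSet Z (f i)) = ∅ := by
      refine Finset.filter_eq_empty_iff.2 fun i _ => ?_
      have := (hf i).1
      simp only [mem_chainSet, Fin.le_def, Fin.ext_iff]
      omega
    simp [sj, hk, h1, h2]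

lemma prod_ofReal_cpow {ι : Type*} (A : Finset ι) {x : ι → ℝ} (hx : ∀ k, 0 < x k) (s : ℂ) :
    ((∏ k ∈ A, x k : ℝ) : ℂ) ^ s = ∏ k ∈ A, (x k : ℂ) ^ s := by
  induction A using Finset.induction_on with
  | empty => simp
  | insert k A hk ih =>
    rw [Finset.prod_insert hk, Finset.prod_insert hk, ← ih, ofReal_mul,
      mul_cpow_ofReal_nonneg (hx k).le (Finset.prod_nonneg fun k _ => (hx k).le)]

lemma prod_prod_chainSet {ι R : Type*} [Fintype ι] [CommMonoid R] (Z : ℕ) (f : ι → Fin n)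
    (u : Fin n → R) : ∏ i, ∏ k ∈ chainSet Z (f i), u k =
      ∏ k, u k ^ (Finset.univ.filter fun i => k ∈ chainSet Z (f i)).card := by
  rw [Finset.prod_comm' (t' := Finset.univ)
    (s' := fun k => Finset.univ.filter fun i => k ∈ chainSet Z (f i)) (by simp)]
  simp

lemma ofReal_chainProd (Z : ℕ) (x : Fin n → ℝ) (j : Fin n) :
    ((chainProd Z x j : ℝ) : ℂ) = chainProd Z (fun k => (x k : ℂ)) j := by
  simp [chainProd]

lemma jacobian_mul_Hfun {a : Fin N → Fin n → ℂ} {Z : ℕ} {f : Fin N → Fin n}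
    (hf : IsLeading a Z f) {x : Fin n → ℝ} (hx : ∀ k, 0 < x k) (s : ℂ) (w : Fin n → ℂ) :
    (((∏ j, chainProd Z x j) / ∏ j, x j : ℝ) : ℂ) * Hfun a (chainProd Z x) s w =
      (∏ k, (x k : ℂ) ^ (sj a Z s k - 1)) *
        (exp (-∑ j, w j * chainProd Z (fun k => (x k : ℂ)) j) /
          ∏ i, rowFactor a Z f (fun k => (x k : ℂ)) i) := by
  have hx' : ∀ k, (x k : ℂ) ≠ 0 := fun k => ofReal_ne_zero.2 (hx k).ne'
  have hφ : ∀ j, ((chainProd Z x j : ℝ) : ℂ) ≠ 0 := fun j =>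
    ofReal_ne_zero.2 (Finset.prod_pos fun k _ => hx k).ne'
  have h1 : ∀ k, (x k : ℂ) ^ (sj a Z s k - 1) =
      ((x k : ℂ) ^ s) ^ (Finset.univ.filter fun j => k ∈ chainSet Z j).card /
        (x k : ℂ) ^ (Finset.univ.filter fun i => k ∈ chainSet Z (f i)).card / x k := fun k => by
    rw [cpow_sub _ _ (hx' k), sj_eq hf, cpow_sub _ _ (hx' k), cpow_nat_mul, cpow_natCast, cpow_one]
  have h2 : ∏ j, ((chainProd Z x j : ℝ) : ℂ) ^ s =
      ∏ k, ((x k : ℂ) ^ s) ^ (Finset.univ.filter fun j => k ∈ chainSet Z j).card := by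
    rw [← prod_prod_chainSet Z (fun j => j)]
    exact Finset.prod_congr rfl fun j _ => prod_ofReal_cpow _ hx s
  have h3 : ∏ i, chainProd Z (fun k => (x k : ℂ)) (f i) =
      ∏ k, (x k : ℂ) ^ (Finset.univ.filter fun i => k ∈ chainSet Z (f i)).card :=
    prod_prod_chainSet Z f _
  have h4 : exp (-∑ j, w j * chainProd Z (fun k => (x k : ℂ)) j) =
      ∏ j, exp (-(w j) * ((chainProd Z x j : ℝ) : ℂ)) := by
    rw [← exp_sum, ← Finset.sum_neg_distrib]
    exact congrArg exp (Finset.sum_congr rfl fun j _ => by rw [ofReal_chainProd, neg_mul])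
  have h5 : ∀ i, ∑ j, a i j * ((chainProd Z x j : ℝ) : ℂ) =
      chainProd Z (fun k => (x k : ℂ)) (f i) * rowFactor a Z f (fun k => (x k : ℂ)) i := fun i => by
    simp only [ofReal_chainProd]
    exact sum_mul_chainProd hf _ i
  have h6 : ∏ j, ((chainProd Z x j : ℝ) : ℂ) ≠ 0 := Finset.prod_ne_zero_iff.2 fun j _ => hφ j
  simp only [Hfun, h1, h5, cpow_sub _ _ (hφ _), cpow_one, Finset.prod_mul_distrib,
    Finset.prod_div_distrib, h2, h3, ← h4, ofReal_div, ofReal_prod]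
  field_simp

lemma re_rowFactor_ge {a : Fin N → Fin n → ℂ} (hH : HypH a) (Z : ℕ) (f : Fin N → Fin n)
    {x : Fin n → ℝ} (hx : ∀ k, 0 ≤ x k) (i : Fin N) :
    (a i (f i)).re ≤ (rowFactor a Z f (fun k => (x k : ℂ)) i).re := by
  have hterm : ∀ j, (a i j * ∏ k ∈ chainSet Z j \ chainSet Z (f i), (x k : ℂ)).re =
      (a i j).re * ∏ k ∈ chainSet Z j \ chainSet Z (f i), x k := fun j => by
    rw [← ofReal_prod, re_mul_ofReal]
  have hnn : ∀ j, 0 ≤ (a i j).re := fun j => by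
    rcases hH.1 i j with h | h
    · simp [h]
    · exact h.le
  rw [rowFactor, re_sum]
  refine le_trans (by simp) (Finset.single_le_sum (fun j _ => ?_) (Finset.mem_univ (f i)))
  rw [hterm]
  exact mul_nonneg (hnn j) (Finset.prod_nonneg fun k _ => hx k)

lemma re_leading_pos {a : Fin N → Fin n → ℂ} (hH : HypH a) {Z : ℕ} {f : Fin N → Fin n}
    (hf : IsLeading a Z f) (i : Fin N) : 0 < (a i (f i)).re :=
  (hH.1 i (f i)).resolve_left (hf i).2.1

lemma re_sum_mul_chainProd_ge {m Z : ℕ} {w : Fin (m + 1) → ℂ} (hw : ∀ k, 0 < (w k).re)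
    {x : Fin (m + 1) → ℝ} (hx : ∀ k, 0 ≤ x k) :
    (w 0).re * x 0 ≤ (∑ j, w j * chainProd Z (fun k => (x k : ℂ)) j).re := by
  have hterm : ∀ j, (w j * chainProd Z (fun k => (x k : ℂ)) j).re = (w j).re * chainProd Z x j :=
    fun j => by rw [← ofReal_chainProd, re_mul_ofReal]
  rw [re_sum]
  simp only [hterm]
  refine le_trans (by simp [chainProd_zero]) (Finset.single_le_sum (fun j _ => ?_)
    (Finset.mem_univ 0))
  exact mul_nonneg (hw j).le (Finset.prod_nonneg fun k _ => hx k)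

end Integrand

section ComplexLaplace

open scoped Topology

lemma norm_cpow_mul_exp_neg_mul {a r : ℂ} {t : ℝ} (ht : 0 < t) :
    ‖(t : ℂ) ^ (a - 1) * exp (-(r * t))‖ = t ^ (a.re - 1) * Real.exp (-r.re * t) := by
  rw [norm_mul, norm_cpow_eq_rpow_re_of_pos ht, norm_exp]
  simp

lemma continuousOn_cpow_mul_exp_neg_mul (a r : ℂ) :
    ContinuousOn (fun t : ℝ => (t : ℂ) ^ (a - 1) * exp (-(r * t))) (Set.Ioi 0) := by
  intro t ht
  refine ContinuousAt.continuousWithinAt (ContinuousAt.mul ?_ ?_)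
  · exact continuous_ofReal.continuousAt.cpow continuousAt_const (Or.inl (by simpa using ht))
  · exact (continuous_exp.comp (continuous_const.mul continuous_ofReal).neg).continuousAt

lemma integrableOn_cpow_mul_exp_neg_mul {a r : ℂ} (ha : 0 < a.re) (hr : 0 < r.re) :
    IntegrableOn (fun t : ℝ => (t : ℂ) ^ (a - 1) * exp (-(r * t))) (Set.Ioi 0) := by
  refine Integrable.mono' (integrableOn_rpow_mul_exp_neg_mul_rpow (s := a.re - 1) (by linarith)
    one_pos hr) ((continuousOn_cpow_mul_exp_neg_mul a r).aestronglyMeasurable measurableSet_Ioi)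
    ((ae_restrict_iff' measurableSet_Ioi).2 (.of_forall fun t ht => ?_))
  rw [norm_cpow_mul_exp_neg_mul ht, Real.rpow_one]

lemma differentiableAt_integral_cpow_mul_exp_neg_mul {a r : ℂ} (ha : 0 < a.re) (hr : 0 < r.re) :
    DifferentiableAt ℂ
      (fun r : ℂ => ∫ t : ℝ in Set.Ioi 0, (t : ℂ) ^ (a - 1) * exp (-(r * t))) r := by
  have hball : ∀ q ∈ Metric.ball r (r.re / 2), r.re / 2 < q.re := by
    intro q hq
    have h1 := (abs_re_le_norm (q - r)).trans_lt (mem_ball_iff_norm.1 hq)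
    rw [sub_re] at h1
    linarith [(abs_lt.1 h1).1]
  have hbound := integrableOn_rpow_mul_exp_neg_mul_rpow (s := a.re) (p := 1) (by linarith)
    one_pos (half_pos hr)
  refine (hasDerivAt_integral_of_dominated_loc_of_deriv_le (μ := volume.restrict (Set.Ioi 0))
    (F := fun (r : ℂ) (t : ℝ) => (t : ℂ) ^ (a - 1) * exp (-(r * t)))
    (F' := fun r t => (t : ℂ) ^ (a - 1) * (exp (-(r * t)) * -t))
    (Metric.ball_mem_nhds r (half_pos hr)) (.of_forall fun q =>
      (continuousOn_cpow_mul_exp_neg_mul a q).aestronglyMeasurable measurableSet_Ioi)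
    (integrableOn_cpow_mul_exp_neg_mul ha hr) ?_ ?_ hbound ?_).2.differentiableAt
  · simp only [← mul_assoc]
    exact ((continuousOn_cpow_mul_exp_neg_mul a r).mul
      continuous_ofReal.neg.continuousOn).aestronglyMeasurable measurableSet_Ioi
  · refine (ae_restrict_iff' measurableSet_Ioi).2 (.of_forall fun t ht q hq => ?_)
    have ht' : (0 : ℝ) < t := ht
    rw [← mul_assoc, norm_mul, norm_cpow_mul_exp_neg_mul ht, norm_neg, norm_real,
      Real.norm_of_nonneg ht'.le, Real.rpow_one, mul_right_comm, Real.rpow_sub_one ht'.ne',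
      div_mul_cancel₀ _ ht'.ne']
    have := hball q hq
    gcongr
  · refine .of_forall fun t q _ => ?_
    have h1 : HasDerivAt (fun q : ℂ => -(q * (t : ℂ))) (-(t : ℂ)) q := by
      convert! ((hasDerivAt_id q).mul_const (t : ℂ)).neg using 1
      simp
    exact h1.cexp.const_mul _

/-- The Laplace transform of a complex power, at a complex parameter. -/
lemma integral_cpow_mul_exp_neg_mul_Ioi_of_re_pos {a r : ℂ} (ha : 0 < a.re) (hr : 0 < r.re) :
    ∫ t : ℝ in Set.Ioi 0, (t : ℂ) ^ (a - 1) * exp (-(r * t)) = (1 / r) ^ a * Gamma a := by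
  have hopen : IsOpen {r : ℂ | 0 < r.re} := isOpen_lt continuous_const continuous_re
  have hf : AnalyticOnNhd ℂ
      (fun r : ℂ => ∫ t : ℝ in Set.Ioi 0, (t : ℂ) ^ (a - 1) * exp (-(r * t))) {r | 0 < r.re} :=
    DifferentiableOn.analyticOnNhd (fun q hq =>
      (differentiableAt_integral_cpow_mul_exp_neg_mul ha hq).differentiableWithinAt) hopen
  have hg : AnalyticOnNhd ℂ (fun r : ℂ => (1 / r) ^ a * Gamma a) {r | 0 < r.re} := by
    intro q hq
    have hq0 : q ≠ 0 := by
      rintro rfl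
      simp at hq
    refine ((analyticAt_const.div analyticAt_id hq0).cpow analyticAt_const ?_).mul analyticAt_const
    left
    show 0 < (1 / q).re
    rw [one_div, inv_re]
    exact div_pos hq (normSq_pos.2 hq0)
  refine hf.eqOn_of_preconnected_of_frequently_eq hg
    (convex_halfSpace_re_gt 0).isPreconnected (z₀ := 1) (by simp) ?_ hr
  have htend : Filter.Tendsto (fun t : ℝ => (t : ℂ)) (𝓝[≠] 1) (𝓝[≠] 1) := by
    refine tendsto_nhdsWithin_iff.2 ⟨?_, ?_⟩
    · simpa using (continuous_ofReal.tendsto 1).mono_left nhdsWithin_le_nhds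
    · filter_upwards [self_mem_nhdsWithin] with t ht
      simpa using ht
  refine htend.frequently (Filter.Eventually.frequently ?_)
  filter_upwards [nhdsWithin_le_nhds (lt_mem_nhds one_pos)] with t ht
  exact integral_cpow_mul_exp_neg_mul_Ioi ha ht

end ComplexLaplace

section IntegralFormula

variable {N m : ℕ}

/-- The function whose Mellin transform over the unit cube computes `Ifun` up to a Gamma factor. -/
def cubeKernel (a : Fin N → Fin (m + 1) → ℂ) (Z : ℕ) (f : Fin N → Fin (m + 1))
    (p : (Fin m → ℂ) × (ℂ × (Fin (m + 1) → ℂ))) : ℂ :=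
  (1 / ∑ j, p.2.2 j * chainProd Z (Fin.cons 1 p.1) j) ^ (((m + 1 : ℕ) : ℂ) * p.2.1 - (N : ℂ)) /
    ∏ i, rowFactor a Z f (Fin.cons 1 p.1) i

lemma sj_zero {a : Fin N → Fin (m + 1) → ℂ} {Z : ℕ} {f : Fin N → Fin (m + 1)}
    (hf : IsLeading a Z f) (s : ℂ) : sj a Z s 0 = ((m + 1 : ℕ) : ℂ) * s - (N : ℂ) := by
  simp [sj_eq hf, zero_mem_chainSet]

lemma chainBox_eq_pi (m : ℕ) : chainBox m =
    Set.univ.pi (Fin.cons (Set.Ioi 0) fun _ : Fin m => Set.Ioo (0 : ℝ) 1) := by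
  ext x
  simp [chainBox, Fin.forall_fin_succ]

lemma integrableOn_chainBox {a : Fin N → Fin (m + 1) → ℂ} (hH : HypH a) {Z : ℕ}
    {f : Fin N → Fin (m + 1)} (hf : IsLeading a Z f) {z : Fin (m + 1) → ℂ}
    (hz : ∀ k, 0 < (z k).re) {w : Fin (m + 1) → ℂ} (hw : ∀ k, 0 < (w k).re) :
    IntegrableOn (fun x : Fin (m + 1) → ℝ => (∏ k, (x k : ℂ) ^ (z k - 1)) *
        (exp (-∑ j, w j * chainProd Z (fun k => (x k : ℂ)) j) /
          ∏ i, rowFactor a Z f (fun k => (x k : ℂ)) i)) (chainBox m) := by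
  have hR : ∀ x ∈ chainBox m, ∀ i, rowFactor a Z f (fun k => (x k : ℂ)) i ≠ 0 := by
    intro x hx i h
    have h1 := re_rowFactor_ge hH Z f (fun k => (pos_of_mem_chainBox hx k).le) i
    rw [h, zero_re] at h1
    exact absurd (re_leading_pos hH hf i) (not_lt.2 h1)
  let h : Fin (m + 1) → ℝ → ℝ := Fin.cons
    (fun t => t ^ ((z 0).re - 1) * Real.exp (-(w 0).re * t ^ (1 : ℝ)))
    fun j t => t ^ ((z j.succ).re - 1)
  have hh : IntegrableOn (fun x : Fin (m + 1) → ℝ => (∏ k, h k (x k)) *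
      (∏ i, (a i (f i)).re)⁻¹) (chainBox m) := by
    refine Integrable.mul_const ?_ _
    rw [chainBox_eq_pi]
    refine integrableOn_pi_prod fun j => ?_
    refine Fin.cases ?_ (fun j => ?_) j
    · exact integrableOn_rpow_mul_exp_neg_mul_rpow (by linarith [hz 0]) one_pos (hw 0)
    · exact integrableOn_rpow_Ioo (hz j.succ)
  refine Integrable.mono' hh ?_ ?_
  · refine ContinuousOn.aestronglyMeasurable (fun x hx => ContinuousAt.continuousWithinAt ?_)
      (measurableSet_chainBox m)
    have hc : ∀ k : Fin (m + 1), Continuous fun x : Fin (m + 1) → ℝ => (x k : ℂ) := fun k =>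
      continuous_ofReal.comp (continuous_apply k)
    refine (tendsto_finsetProd _ fun k _ => ?_).mul (ContinuousAt.div ?_ ?_ ?_)
    · exact (hc k).continuousAt.cpow continuousAt_const
        (Or.inl (by simpa using pos_of_mem_chainBox hx k))
    · exact (continuous_exp.comp (continuous_finsetSum _ fun j _ => continuous_const.mul
        (continuous_finsetProd _ fun k _ => hc k)).neg).continuousAt
    · exact (continuous_finsetProd _ fun i _ => continuous_finsetSum _ fun j _ =>
        continuous_const.mul (continuous_finsetProd _ fun k _ => hc k)).continuousAt
    · exact Finset.prod_ne_zero_iff.2 fun i _ => hR x hx i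
  · refine (ae_restrict_iff' (measurableSet_chainBox m)).2 (.of_forall fun x hx => ?_)
    have hpos := pos_of_mem_chainBox hx
    have h1 : ∀ k, ‖(x k : ℂ) ^ (z k - 1)‖ = x k ^ ((z k).re - 1) := fun k => by
      rw [norm_cpow_eq_rpow_re_of_pos (hpos k)]
      simp
    have h2 : (∏ i, (a i (f i)).re) ≤ ∏ i, ‖rowFactor a Z f (fun k => (x k : ℂ)) i‖ :=
      Finset.prod_le_prod (fun i _ => (re_leading_pos hH hf i).le) fun i _ =>
        (re_rowFactor_ge hH Z f (fun k => (hpos k).le) i).trans (re_le_norm _)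
    have h3 : Real.exp (-(∑ j, w j * chainProd Z (fun k => (x k : ℂ)) j).re) ≤
        Real.exp (-(w 0).re * x 0) := by
      have := re_sum_mul_chainProd_ge (Z := Z) hw (fun k => (hpos k).le)
      exact Real.exp_le_exp.2 (by linarith)
    have h4 : ∏ k, h k (x k) = (∏ k, x k ^ ((z k).re - 1)) * Real.exp (-(w 0).re * x 0) := by
      simp only [Fin.prod_univ_succ, h, Fin.cons_zero, Fin.cons_succ, Real.rpow_one]
      ring
    have h5 : 0 < ∏ i, (a i (f i)).re := Finset.prod_pos fun i _ => re_leading_pos hH hf i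
    rw [norm_mul, norm_div, norm_prod, norm_prod, norm_exp, neg_re, h4, mul_assoc,
      Finset.prod_congr rfl fun k _ => h1 k, ← div_eq_mul_inv]
    refine mul_le_mul_of_nonneg_left ?_
      (Finset.prod_nonneg fun k _ => Real.rpow_nonneg (hpos k).le _)
    gcongr

lemma Ifun_eq_Gamma_mul {a : Fin N → Fin (m + 1) → ℂ} (hH : HypH a) {Z : ℕ}
    {f : Fin N → Fin (m + 1)} (hf : IsLeading a Z f) {s : ℂ} (hs : ∀ k, 0 < (sj a Z s k).re)
    {w : Fin (m + 1) → ℂ} (hw : ∀ k, 0 < (w k).re) :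
    Ifun a Z s w = Gamma (((m + 1 : ℕ) : ℂ) * s - (N : ℂ)) *
      ∫ y in Set.univ.pi fun _ : Fin m => Set.Ioo (0 : ℝ) 1,
        (∏ j, (y j : ℂ) ^ (sj a Z s j.succ - 1)) *
          cubeKernel a Z f (fun j => (y j : ℂ), (s, w)) := by
  have hint := integrableOn_chainBox hH hf hs hw
  rw [Ifun, setIntegral_deltaRegion, setIntegral_congr_fun (measurableSet_chainBox m)
    fun x hx => jacobian_mul_Hfun hf (pos_of_mem_chainBox hx) s w]
  rw [chainBox] at hint ⊢
  rw [setIntegral_fin_cons hint, ← integral_const_mul]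
  refine setIntegral_congr_fun (MeasurableSet.univ_pi fun _ => measurableSet_Ioo) fun y hy => ?_
  have hcast : ∀ t : ℝ, (fun k => (((Fin.cons t y : Fin (m + 1) → ℝ) k : ℝ) : ℂ)) =
      Fin.cons (t : ℂ) fun j => (y j : ℂ) := fun t => by
    ext j
    refine Fin.cases ?_ (fun j => ?_) j <;> simp
  have hφ : ∀ (t : ℂ) (j : Fin (m + 1)), chainProd Z (Fin.cons t fun j => (y j : ℂ)) j =
      t * chainProd Z (Fin.cons 1 fun j => (y j : ℂ)) j := fun t j => by
    rw [chainProd, chainProd, ← Finset.mul_prod_erase _ _ (zero_mem_chainSet Z j),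
      ← Finset.mul_prod_erase _ _ (zero_mem_chainSet Z j), Fin.cons_zero, Fin.cons_zero, one_mul]
    congr 1
    refine Finset.prod_congr rfl fun k hk => ?_
    obtain ⟨k, rfl⟩ := Fin.exists_succ_eq.2 (Finset.ne_of_mem_erase hk)
    simp
  have hR : ∀ (t : ℂ) (i : Fin N), rowFactor a Z f (Fin.cons t fun j => (y j : ℂ)) i =
      rowFactor a Z f (Fin.cons 1 fun j => (y j : ℂ)) i := fun t i => by
    refine Finset.sum_congr rfl fun j _ => congrArg _ (Finset.prod_congr rfl fun k hk => ?_)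
    have hk0 : k ≠ 0 := by
      rintro rfl
      exact (Finset.mem_sdiff.1 hk).2 (zero_mem_chainSet Z _)
    obtain ⟨k, rfl⟩ := Fin.exists_succ_eq.2 hk0
    simp
  have hW : 0 < (∑ j, w j * chainProd Z (Fin.cons 1 fun j => (y j : ℂ)) j).re := by
    have h1 := re_sum_mul_chainProd_ge (Z := Z) hw (x := Fin.cons 1 y)
      (Fin.forall_fin_succ.2 ⟨by simp, fun j => by simpa using (hy j trivial).1.le⟩)
    rw [hcast, ofReal_one, Fin.cons_zero, mul_one] at h1
    exact (hw 0).trans_le h1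
  have hG := integral_cpow_mul_exp_neg_mul_Ioi_of_re_pos
    (r := ∑ j, w j * chainProd Z (Fin.cons 1 fun j => (y j : ℂ)) j) (hs 0) hW
  rw [sj_zero hf] at hG
  have hterm : ∀ t : ℝ, -∑ j, w j * chainProd Z (Fin.cons (t : ℂ) fun j => (y j : ℂ)) j =
      -((∑ j, w j * chainProd Z (Fin.cons 1 fun j => (y j : ℂ)) j) * t) := fun t => by
    rw [Finset.sum_mul]
    exact congrArg _ (Finset.sum_congr rfl fun j _ => by rw [hφ]; ring)
  simp only [Fin.prod_univ_succ, hcast, Fin.cons_zero, Fin.cons_succ, hR _, cubeKernel,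
    sj_zero hf, hterm]
  have hG' := congrArg (fun u => (∏ j, (y j : ℂ) ^ (sj a Z s j.succ - 1)) /
    (∏ i, rowFactor a Z f (Fin.cons 1 fun j => (y j : ℂ)) i) * u) hG
  simp only [← integral_const_mul] at hG'
  convert! hG' using 1
  · congr 1; ext t
    ring
  · ring

end IntegralFormula

section Continuation

open scoped Topology

variable {N m : ℕ}

lemma analyticAt_cubeKernel {a : Fin N → Fin (m + 1) → ℂ} (hH : HypH a) {Z : ℕ}
    {f : Fin N → Fin (m + 1)} (hf : IsLeading a Z f) {y : Fin m → ℝ}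
    (hy : ∀ j, y j ∈ Set.Icc (0 : ℝ) 1) {e : ℂ × (Fin (m + 1) → ℂ)} (he : ∀ k, 0 < (e.2 k).re) :
    AnalyticAt ℂ (cubeKernel a Z f) (fun j => (y j : ℂ), e) := by
  have hcast : (fun k => (((Fin.cons 1 y : Fin (m + 1) → ℝ) k : ℝ) : ℂ)) =
      Fin.cons 1 fun j => (y j : ℂ) := by
    ext j
    refine Fin.cases ?_ (fun j => ?_) j <;> simp
  have hy0 : ∀ k, 0 ≤ (Fin.cons 1 y : Fin (m + 1) → ℝ) k :=
    Fin.forall_fin_succ.2 ⟨by simp, fun j => by simpa using (hy j).1⟩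
  have hx : ∀ k, AnalyticAt ℂ (fun p : (Fin m → ℂ) × (ℂ × (Fin (m + 1) → ℂ)) =>
      (Fin.cons 1 p.1 : Fin (m + 1) → ℂ) k) (fun j => (y j : ℂ), e) :=
    analyticAt_pi_iff.1 (analyticAt_fin_cons analyticAt_const analyticAt_fst)
  have hw : ∀ k, AnalyticAt ℂ (fun p : (Fin m → ℂ) × (ℂ × (Fin (m + 1) → ℂ)) => p.2.2 k)
      (fun j => (y j : ℂ), e) :=
    analyticAt_pi_iff.1 (analyticAt_snd.comp analyticAt_snd)
  have hW : 0 < (∑ j, e.2 j * chainProd Z (Fin.cons 1 fun j => (y j : ℂ)) j).re := by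
    have h1 := re_sum_mul_chainProd_ge (Z := Z) he hy0
    rw [hcast, Fin.cons_zero, mul_one] at h1
    exact (he 0).trans_le h1
  have hW0 : ∑ j, e.2 j * chainProd Z (Fin.cons 1 fun j => (y j : ℂ)) j ≠ 0 := fun h => by
    rw [h, zero_re] at hW
    exact lt_irrefl _ hW
  refine AnalyticAt.div (AnalyticAt.cpow (AnalyticAt.div analyticAt_const ?_ hW0) ?_ (Or.inl ?_))
    (Finset.analyticAt_fun_prod _ fun i _ => Finset.analyticAt_fun_sum _ fun j _ =>
      analyticAt_const.mul (Finset.analyticAt_fun_prod _ fun k _ => hx k)) ?_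
  · exact Finset.analyticAt_fun_sum _ fun j _ =>
      (hw j).mul (Finset.analyticAt_fun_prod _ fun k _ => hx k)
  · exact (analyticAt_const.mul (analyticAt_fst.comp analyticAt_snd)).sub analyticAt_const
  · rw [one_div, inv_re]
    exact div_pos hW (normSq_pos.2 hW0)
  · refine Finset.prod_ne_zero_iff.2 fun i _ h => ?_
    have h1 := re_rowFactor_ge hH Z f hy0 i
    rw [hcast, h, zero_re] at h1
    exact absurd (re_leading_pos hH hf i) (not_lt.2 h1)

lemma analyticAt_sj {n : ℕ} {a : Fin N → Fin n → ℂ} {Z : ℕ} {f : Fin N → Fin n}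
    (hf : IsLeading a Z f) {V : Type*} [NormedAddCommGroup V] [NormedSpace ℂ V] {u : V → ℂ} {v : V}
    (hu : AnalyticAt ℂ u v) (k : Fin n) : AnalyticAt ℂ (fun v => sj a Z (u v) k) v := by
  simp only [sj_eq hf]
  exact (analyticAt_const.mul hu).sub analyticAt_const

theorem exists_Ifun_factorization {a : Fin N → Fin (m + 1) → ℂ} (hH : HypH a) {Z : ℕ}
    {f : Fin N → Fin (m + 1)} (hf : IsLeading a Z f) :
    ∃ F : ℂ × (Fin (m + 1) → ℂ) → ℂ, (∀ p, (∀ k, 0 < (p.2 k).re) → AnalyticAt ℂ F p) ∧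
      ∀ p, (∀ k, 0 < (sj a Z p.1 k).re) → (∀ k, 0 < (p.2 k).re) →
        Ifun a Z p.1 p.2 = Gamma (((m + 1 : ℕ) : ℂ) * p.1 - (N : ℂ)) *
          ((∏ j : Fin m, Gamma (sj a Z p.1 j.succ)) * F p) := by
  obtain ⟨F, hF, hFI⟩ := exists_mellin_continuation m
    {e : ℂ × (Fin (m + 1) → ℂ) | ∀ k, 0 < (e.2 k).re} (cubeKernel a Z f)
    fun y hy e he => analyticAt_cubeKernel hH hf hy he
  refine ⟨fun p => F (fun j => sj a Z p.1 j.succ, p), fun p hp => ?_, fun p hp hw => ?_⟩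
  · exact (hF (fun j => sj a Z p.1 j.succ) p hp).comp_of_eq
      (f := fun p : ℂ × (Fin (m + 1) → ℂ) => ((fun j : Fin m => sj a Z p.1 j.succ), p))
      ((analyticAt_pi_iff.2 fun j : Fin m => analyticAt_sj hf analyticAt_fst j.succ).prod
        analyticAt_id) rfl
  · rw [Ifun_eq_Gamma_mul hH hf hp hw]
    exact congrArg _ (hFI (fun j => sj a Z p.1 j.succ) (fun j => hp j.succ) p hw)

lemma sj_eq_of_le {n : ℕ} {a : Fin N → Fin n → ℂ} {Z : ℕ} {f : Fin N → Fin n}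
    (hf : IsLeading a Z f) {k : Fin n} (hk : (k : ℕ) ≤ Z) :
    ∃ d : ℕ, d ≤ N ∧ ∀ s, sj a Z s k = ((n : ℂ) - (k : ℕ)) * s - d := by
  refine ⟨_, (Finset.card_le_univ (Finset.univ.filter fun i => k ∈ chainSet Z (f i))).trans_eq
    (Fintype.card_fin N), fun s => ?_⟩
  have h0 := sj_eq hf 0 k
  rw [sj, if_pos hk, mul_zero, mul_zero, zero_sub, zero_sub, neg_inj] at h0
  rw [sj, if_pos hk, h0]

lemma re_sj_pos {n : ℕ} {a : Fin N → Fin n → ℂ} {Z : ℕ} {f : Fin N → Fin n}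
    (hf : IsLeading a Z f) (hZ : Z < n) {s : ℂ} (hs : (N : ℝ) / ((n : ℝ) - (Z : ℝ)) < s.re)
    (k : Fin n) : 0 < (sj a Z s k).re := by
  have hZ' : (0 : ℝ) < n - Z := sub_pos.2 (by exact_mod_cast hZ)
  have hs0 : 0 < s.re := lt_of_le_of_lt (by positivity) hs
  by_cases hk : (k : ℕ) ≤ Z
  · obtain ⟨d, hd, h⟩ := sj_eq_of_le hf hk
    have h1 : (sj a Z s k).re = ((n : ℝ) - (k : ℕ)) * s.re - d := by simp [h]
    have h2 : (N : ℝ) < (n - Z) * s.re := by rwa [div_lt_iff₀' hZ'] at hs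
    have hk' : ((k : ℕ) : ℝ) ≤ Z := by exact_mod_cast hk
    have hd' : (d : ℝ) ≤ N := by exact_mod_cast hd
    nlinarith
  · rwa [sj, if_neg hk]

lemma re_sj_add_pos {n : ℕ} {a : Fin N → Fin n → ℂ} {Z : ℕ} {f : Fin N → Fin n}
    (hf : IsLeading a Z f) {M : ℕ} (hM : N ≤ M) {s : ℂ} (hs : ((N : ℝ) - M) / n < s.re)
    (k : Fin n) : 0 < (sj a Z s k + ((M + 1 : ℕ) : ℂ)).re := by
  have hn1 : (1 : ℝ) ≤ n := by exact_mod_cast (Nat.succ_le_of_lt k.pos)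
  have hn : (0 : ℝ) < n := by linarith
  have hs' : (N : ℝ) - M < n * s.re := by rwa [div_lt_iff₀' hn] at hs
  have hM' : (N : ℝ) ≤ M := by exact_mod_cast hM
  have hN : (0 : ℝ) ≤ N := Nat.cast_nonneg N
  have hkn : ((k : ℕ) : ℝ) < n := by exact_mod_cast k.2
  have hk0 : (0 : ℝ) ≤ (k : ℕ) := Nat.cast_nonneg _
  by_cases hk : (k : ℕ) ≤ Z
  · obtain ⟨d, hd, h⟩ := sj_eq_of_le hf hk
    have h1 : (sj a Z s k + ((M + 1 : ℕ) : ℂ)).re =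
        ((n : ℝ) - (k : ℕ)) * s.re - d + (M + 1) := by simp [h]
    have hd' : (d : ℝ) ≤ N := by exact_mod_cast hd
    rcases le_total 0 s.re with h0 | h0 <;> nlinarith
  · have h1 : (sj a Z s k + ((M + 1 : ℕ) : ℂ)).re = s.re + (M + 1) := by simp [sj, hk]
    rcases le_total 0 s.re with h0 | h0 <;> nlinarith

lemma isOpen_re_region {n : ℕ} (c : ℝ) :
    IsOpen {p : ℂ × (Fin n → ℂ) | c < p.1.re ∧ ∀ k, 0 < (p.2 k).re} := by
  refine (isOpen_lt continuous_const (continuous_re.comp continuous_fst)).inter ?_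
  have : {p : ℂ × (Fin n → ℂ) | ∀ k, 0 < (p.2 k).re} = ⋂ k, {p | 0 < (p.2 k).re} := by
    ext
    simp
  change IsOpen {p : ℂ × (Fin n → ℂ) | ∀ k, 0 < (p.2 k).re}
  rw [this]
  exact isOpen_iInter_of_finite fun k => isOpen_lt continuous_const
    (continuous_re.comp ((continuous_apply k).comp continuous_snd))

lemma analyticAt_Gamma_of_re_pos {z : ℂ} (hz : 0 < z.re) : AnalyticAt ℂ Gamma z := by
  have h := (analyticAt_Gamma_inv z).inv (inv_ne_zero (Gamma_ne_zero_of_re_pos hz))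
  simpa [Function.comp_def, Pi.inv_def] using h

lemma meromorphicAt_Gamma_comp {u : ℂ → ℂ} {z : ℂ} (hu : AnalyticAt ℂ u z) :
    MeromorphicAt (fun z => Gamma (u z)) z := by
  have h := ((analyticAt_Gamma_inv (u z)).comp hu).meromorphicAt.inv
  simpa [Function.comp_def, Pi.inv_def] using h

lemma Gamma_add_nat_eq_prod_mul {z : ℂ} {k : ℕ} (h : ∀ q ∈ Finset.range k, (q : ℂ) + z ≠ 0) :
    Gamma (z + (k : ℂ)) = (∏ q ∈ Finset.range k, ((q : ℂ) + z)) * Gamma z := by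
  induction k with
  | zero => simp
  | succ k ih =>
    have h1 := h k (Finset.self_mem_range_succ k)
    rw [Finset.prod_range_succ, Nat.cast_succ, ← add_assoc, Gamma_add_one _ (by rwa [add_comm]),
      ih fun q hq => h q (Finset.mem_range.2 ((Finset.mem_range.1 hq).trans (Nat.lt_succ_self k)))]
    ring

lemma prod_filter_pos_fin {R : Type*} [CommMonoid R] (u : Fin (m + 1) → R) :
    ∏ j ∈ Finset.univ.filter (fun j : Fin (m + 1) => 0 < (j : ℕ)), u j = ∏ j : Fin m, u j.succ := by
  rw [Finset.prod_filter, Fin.prod_univ_succ]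
  simp

end Continuation

/-- Lemma 1 of the paper: `I(s,w)` is analytic for `Re s > N/(n-Z)`, `Re w_k > 0`,
has a meromorphic continuation in `s` to all of `ℂ` (for each fixed admissible `w`),
and for every integer `M' ≥ N` the function `I(s,w)/Γ(ns-N) · Π_{p=0}^{M'} Π_{j=2}^n (p+s_j)`
is analytic in `(s,w)` on `Re s > (N-M')/n`, `Re w_k > 0`. -/
theorem Ifun_analytic_and_meromorphic_continuation {N n : ℕ} (hN : 0 < N) (hn : 0 < n)
    (a : Fin N → Fin n → ℂ) (hH : HypH a) (Z : ℕ) (hZn : Z < n)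
    (hrow : ∀ i, ((Finset.univ.filter fun j => a i j = 0).card ≤ Z)) :
    AnalyticOnNhd ℂ (fun p : ℂ × (Fin n → ℂ) => Ifun a Z p.1 p.2)
      {p | (N : ℝ) / ((n : ℝ) - (Z : ℝ)) < p.1.re ∧ ∀ k, 0 < (p.2 k).re} ∧
    ∃ Ic : ℂ × (Fin n → ℂ) → ℂ,
      (∀ p : ℂ × (Fin n → ℂ),
        (N : ℝ) / ((n : ℝ) - (Z : ℝ)) < p.1.re → (∀ k, 0 < (p.2 k).re) →
        Ic p = Ifun a Z p.1 p.2) ∧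
      (∀ w : Fin n → ℂ, (∀ k, 0 < (w k).re) →
        MeromorphicOn (fun s => Ic (s, w)) Set.univ) ∧
      (∀ M' : ℕ, N ≤ M' → ∃ G : ℂ × (Fin n → ℂ) → ℂ,
        AnalyticOnNhd ℂ G {p | ((N : ℝ) - (M' : ℝ)) / (n : ℝ) < p.1.re ∧ ∀ k, 0 < (p.2 k).re} ∧
        ∀ p : ℂ × (Fin n → ℂ),
          ((N : ℝ) - (M' : ℝ)) / (n : ℝ) < p.1.re → (∀ k, 0 < (p.2 k).re) →
          Complex.Gamma ((n : ℂ) * p.1 - (N : ℂ)) ≠ 0 →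
          (∏ q ∈ Finset.range (M' + 1),
            ∏ j ∈ Finset.univ.filter (fun j : Fin n => 0 < (j : ℕ)),
              ((q : ℂ) + sj a Z p.1 j)) ≠ 0 →
          Ic p = G p * Complex.Gamma ((n : ℂ) * p.1 - (N : ℂ)) /
            ∏ q ∈ Finset.range (M' + 1),
              ∏ j ∈ Finset.univ.filter (fun j : Fin n => 0 < (j : ℕ)),
                ((q : ℂ) + sj a Z p.1 j)) := by
  obtain ⟨m, rfl⟩ := Nat.exists_eq_succ_of_ne_zero hn.ne'
  obtain ⟨f, hf⟩ := exists_isLeading hH hrow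
  obtain ⟨F, hF, hFI⟩ := exists_Ifun_factorization hH hf
  have hI : ∀ p : ℂ × (Fin (m + 1) → ℂ), (N : ℝ) / (((m + 1 : ℕ) : ℝ) - (Z : ℝ)) < p.1.re →
      (∀ k, 0 < (p.2 k).re) → Gamma (((m + 1 : ℕ) : ℂ) * p.1 - (N : ℂ)) *
        ((∏ j : Fin m, Gamma (sj a Z p.1 j.succ)) * F p) = Ifun a Z p.1 p.2 :=
    fun p hs hw => (hFI p (re_sj_pos hf hZn hs) hw).symm
  refine ⟨fun p hp => ?_, fun p => Gamma (((m + 1 : ℕ) : ℂ) * p.1 - (N : ℂ)) *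
    ((∏ j : Fin m, Gamma (sj a Z p.1 j.succ)) * F p), hI, fun w hw s _ => ?_,
    fun M hM => ⟨fun p => F p * ∏ j : Fin m, Gamma (sj a Z p.1 j.succ + ((M + 1 : ℕ) : ℂ)),
      fun p hp => ?_, fun p hs hw _ hne => ?_⟩⟩
  · have hpos := re_sj_pos hf hZn hp.1
    have hG : ∀ k, AnalyticAt ℂ (fun p : ℂ × (Fin (m + 1) → ℂ) => Gamma (sj a Z p.1 k)) p :=
      fun k => (analyticAt_Gamma_of_re_pos (hpos k)).comp_of_eq
        (f := fun p : ℂ × (Fin (m + 1) → ℂ) => sj a Z p.1 k) (analyticAt_sj hf analyticAt_fst k) rfl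
    have h0 := hG 0
    simp only [sj_zero hf] at h0
    refine (h0.mul ((Finset.analyticAt_fun_prod Finset.univ fun (j : Fin m) _ => hG j.succ).mul
      (hF p hp.2))).congr ?_
    filter_upwards [(isOpen_re_region _).mem_nhds hp] with q hq
    exact hI q hq.1 hq.2
  · have hG : ∀ k, MeromorphicAt (fun s => Gamma (sj a Z s k)) s := fun k =>
      meromorphicAt_Gamma_comp (analyticAt_sj hf analyticAt_id k)
    have h0 := hG 0
    simp only [sj_zero hf] at h0
    refine h0.mul ((MeromorphicAt.fun_prod fun (j : Fin m) _ => hG j.succ).mul ?_)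
    exact ((hF (s, w) hw).comp_of_eq (f := fun s : ℂ => (s, w))
      (analyticAt_id.prod analyticAt_const) rfl).meromorphicAt
  · refine (hF p hp.2).mul (Finset.analyticAt_fun_prod _ fun j _ => ?_)
    exact (analyticAt_Gamma_of_re_pos (re_sj_add_pos hf hM hp.1 j.succ)).comp_of_eq
      (f := fun p : ℂ × (Fin (m + 1) → ℂ) => sj a Z p.1 j.succ + ((M + 1 : ℕ) : ℂ))
      ((analyticAt_sj hf analyticAt_fst j.succ).add analyticAt_const) rfl
  · simp only [prod_filter_pos_fin] at hne ⊢
    have hne' : ∀ j : Fin m, ∀ q ∈ Finset.range (M + 1), (q : ℂ) + sj a Z p.1 j.succ ≠ 0 :=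
      fun j q hq => Finset.prod_ne_zero_iff.1 (Finset.prod_ne_zero_iff.1 hne q hq) j
        (Finset.mem_univ j)
    rw [eq_div_iff hne, Finset.prod_congr rfl fun j _ => Gamma_add_nat_eq_prod_mul (hne' j),
      Finset.prod_mul_distrib, Finset.prod_comm]
    ring
end
end
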